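/- arXiv:2305.15585 — 2 statements merged into one kernel-verified Lean document; each statement's English description precedes it below -/
import Mathlib

section
/- For every positive integer χ there are arbitrarily large N for which there exist a triangle-free graph G and a tournament T on the same N-element vertex set such that χ(G) = χ and, for every set U of at most (log N)/(2χ²) vertices, the subgraph of G induced on the out-neighbourhood N⁺_T(U) has chromatic number at most 2. (Formally: for every χ ≥ 1 and every M there exist N ≥ M, a triangle-free graph G on an N-element vertex set V, and a tournament T on V, with χ(G) = χ and χ(G[N⁺_T(U)]) ≤ 2 for every U ⊆ V with |U| ≤ (log N)/(2χ²).) -/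
/-- A tournament on `V`: an orientation of the complete graph, i.e. an irreflexive
relation such that for distinct vertices exactly one direction is present. -/
def IsTournament {V : Type*} (r : V → V → Prop) : Prop :=
  (∀ v, ¬ r v v) ∧ ∀ u v : V, u ≠ v → (r u v ↔ ¬ r v u)


namespace Fan
set_option linter.unusedSectionVars false
open Finset

variable {X : Type*} [DecidableEq X]

abbrev Ch (X : Type*) := Finset X →₀ ZMod 2

noncomputable def bd : Ch X →ₗ[ZMod 2] Ch X :=
  Finsupp.linearCombination (ZMod 2) (fun σ : Finset X => ∑ v ∈ σ, Finsupp.single (σ.erase v) (1 : ZMod 2))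

noncomputable def cone (w : X) : Ch X →ₗ[ZMod 2] Ch X :=
  Finsupp.linearCombination (ZMod 2)
    (fun σ : Finset X => if w ∈ σ then 0 else Finsupp.single (insert w σ) (1 : ZMod 2))

noncomputable def hh (v w : X) : Ch X →ₗ[ZMod 2] Ch X :=
  Finsupp.linearCombination (ZMod 2)
    (fun σ : Finset X => if v ∈ σ ∧ w ∉ σ then Finsupp.single (insert w σ) (1 : ZMod 2) else 0)

noncomputable def phi (v w : X) : Ch X →ₗ[ZMod 2] Ch X :=
  Finsupp.linearCombination (ZMod 2)
    (fun σ : Finset X => if v ∉ σ then Finsupp.single σ (1 : ZMod 2) else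
      if w ∈ σ then 0 else Finsupp.single (insert w (σ.erase v)) (1 : ZMod 2))

noncomputable abbrev S (σ : Finset X) : Ch X := Finsupp.single σ 1

lemma bd_S (σ : Finset X) : bd (S σ) = ∑ v ∈ σ, S (σ.erase v) := by
  simp [bd, S]

lemma cone_S (w : X) (σ : Finset X) : cone w (S σ) = if w ∈ σ then 0 else S (insert w σ) := by
  simp [cone, S]

lemma hh_S (v w : X) (σ : Finset X) :
    hh v w (S σ) = if v ∈ σ ∧ w ∉ σ then S (insert w σ) else 0 := by
  simp [hh, S]

lemma phi_S (v w : X) (σ : Finset X) : phi v w (S σ) = if v ∉ σ then S σ else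
      if w ∈ σ then 0 else S (insert w (σ.erase v)) := by
  simp [phi, S]

lemma add_self' (c : Ch X) : c + c = 0 := by
  ext σ
  simp [CharTwo.add_self_eq_zero]

lemma lin_ext {N : Type*} [AddCommMonoid N] [Module (ZMod 2) N] (f g : Ch X →ₗ[ZMod 2] N)
    (h : ∀ σ, f (S σ) = g (S σ)) : f = g := by
  apply Finsupp.lhom_ext'
  intro σ
  apply LinearMap.ext_ring
  simpa using h σ

lemma cone_bd_S (w : X) (σ : Finset X) : bd (cone w (S σ)) + cone w (bd (S σ)) = S σ := by
  rw [bd_S, map_sum, cone_S]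
  by_cases hw : w ∈ σ
  · rw [if_pos hw, map_zero, zero_add, Finset.sum_eq_single w]
    · rw [cone_S, if_neg (by simp), Finset.insert_erase hw]
    · intro b hb hbw
      rw [cone_S, if_pos]
      simp [hw, Ne.symm hbw]
    · exact fun h => absurd hw h
  · rw [if_neg hw, bd_S, Finset.sum_insert hw, Finset.erase_insert hw, add_assoc,
      ← Finset.sum_add_distrib, Finset.sum_eq_zero, add_zero]
    intro x hx
    rw [cone_S, if_neg (by simp [hw])]
    have : w ≠ x := by rintro rfl; exact hw hx
    rw [Finset.erase_insert_of_ne this, add_self']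

lemma cone_bd (w : X) (c : Ch X) : bd (cone w c) + cone w (bd c) = c := by
  have : bd ∘ₗ cone w + cone w ∘ₗ bd = LinearMap.id := lin_ext _ _ (fun σ => by
    simpa using cone_bd_S w σ)
  simpa using congrArg (fun f => f c) this

lemma bd_bd_S (σ : Finset X) : bd (bd (S σ)) = 0 := by
  induction σ using Finset.induction_on with
  | empty => simp [bd_S]
  | insert w τ hw ih =>
    have h : S (insert w τ) = cone w (S τ) := by rw [cone_S, if_neg hw]
    have h1 := cone_bd w (S τ)
    have h2 := cone_bd w (bd (S τ))
    rw [ih, map_zero, add_zero] at h2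
    have h3 := congrArg bd h1
    rw [map_add, h2] at h3
    rw [h]
    simpa using h3

lemma bd_bd (c : Ch X) : bd (bd c) = 0 := by
  have : bd ∘ₗ bd = (0 : Ch X →ₗ[ZMod 2] Ch X) := lin_ext _ _ (fun σ => by
    simpa using bd_bd_S σ)
  simpa using congrArg (fun f => f c) this

lemma phi_eq_S (v w : X) (hvw : v ≠ w) (σ : Finset X) :
    S σ + bd (hh v w (S σ)) + hh v w (bd (S σ)) = phi v w (S σ) := by
  rw [bd_S, map_sum, hh_S, phi_S]
  by_cases hv : v ∈ σ
  · by_cases hw : w ∈ σ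
    · rw [if_neg (by simp [hw]), if_neg (by simp [hv]), if_pos hw, map_zero, add_zero,
        Finset.sum_eq_single w]
      · rw [hh_S, if_pos (by simp [hv, hvw]), Finset.insert_erase hw, add_self']
      · intro b hb hbw
        rw [hh_S, if_neg]
        simp [hw, Ne.symm hbw]
      · exact fun h => absurd hw h
    · rw [if_pos ⟨hv, hw⟩, if_neg (by simp [hv]), if_neg hw, bd_S, Finset.sum_insert hw,
        Finset.erase_insert hw, ← add_assoc, add_self', zero_add, ← Finset.sum_add_distrib,
        Finset.sum_eq_single v]
      · rw [hh_S, if_neg (by simp), add_zero, Finset.erase_insert_of_ne (Ne.symm hvw)]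
      · intro b hb hbv
        have : w ≠ b := by rintro rfl; exact hw hb
        rw [hh_S, if_pos (by simp [hw, hv, Ne.symm hbv]), Finset.erase_insert_of_ne this, add_self']
      · exact fun h => absurd hv h
  · rw [if_neg (by simp [hv]), if_pos hv, map_zero, add_zero, Finset.sum_eq_zero, add_zero]
    intro x hx
    rw [hh_S, if_neg (by simp [hv])]

lemma phi_eq (v w : X) (hvw : v ≠ w) (c : Ch X) :
    c + bd (hh v w c) + hh v w (bd c) = phi v w c := by
  have : LinearMap.id + bd ∘ₗ hh v w + hh v w ∘ₗ bd = phi v w := lin_ext _ _ (fun σ => by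
    simpa using phi_eq_S v w hvw σ)
  simpa using congrArg (fun f => f c) this

/-- cliques of size n inside W -/
def KK (adj : X → X → Prop) (W : Finset X) (n : ℕ) : Set (Finset X) :=
  {σ | σ ⊆ W ∧ σ.card = n ∧ ∀ u ∈ σ, ∀ v ∈ σ, adj u v}

abbrev Sp (adj : X → X → Prop) (W : Finset X) (n : ℕ) : Submodule (ZMod 2) (Ch X) :=
  Finsupp.supported (ZMod 2) (ZMod 2) (KK adj W n)

lemma sp_map {s : Set (Finset X)} {N : Type*} [AddCommMonoid N] [Module (ZMod 2) N]
    (p : Submodule (ZMod 2) N) (f : Ch X →ₗ[ZMod 2] N)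
    (h : ∀ σ ∈ s, f (S σ) ∈ p) (c : Ch X) (hc : c ∈ Finsupp.supported (ZMod 2) (ZMod 2) s) :
    f c ∈ p := by
  rw [Finsupp.supported_eq_span_single] at hc
  have : Submodule.span (ZMod 2) ((fun i => Finsupp.single i (1 : ZMod 2)) '' s) ≤ p.comap f := by
    rw [Submodule.span_le]
    rintro _ ⟨σ, hσ, rfl⟩
    exact h σ hσ
  exact this hc

lemma S_mem {adj : X → X → Prop} {W : Finset X} {n : ℕ} {σ : Finset X} (h : σ ∈ KK adj W n) :
    S σ ∈ Sp adj W n := Finsupp.single_mem_supported _ _ h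

def Acyc (adj : X → X → Prop) (W : Finset X) : Prop :=
  ∀ n, ∀ c ∈ Sp adj W n, bd c = 0 → ∃ d ∈ Sp adj W (n+1), bd d = c

lemma acyc_dism {L : Type*} [LinearOrder L] (key : X → L)
    (adj : X → X → Prop) (hr : ∀ x, adj x x) (hs : ∀ x y, adj x y → adj y x) (root : X) :
    ∀ k : ℕ, ∀ W : Finset X, W.card = k → root ∈ W → (∀ u ∈ W, key u ≤ key root) →
    (∀ v ∈ W, v ≠ root → ∃ w ∈ W, key v < key w ∧
      ∀ u ∈ W, key v ≤ key u → adj v u → adj w u) → Acyc adj W := by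
  intro k
  induction k with
  | zero =>
    intro W hW hroot
    simp at hW; simp [hW] at hroot
  | succ k ih =>
    intro W hW hroot hmax hdom
    by_cases hne : (W.erase root).Nonempty
    · obtain ⟨v, hv, hmin⟩ := Finset.exists_min_image _ key hne
      have hvr : v ≠ root := (Finset.mem_erase.1 hv).1
      have hvW : v ∈ W := (Finset.mem_erase.1 hv).2
      have hmin' : ∀ u ∈ W, key v ≤ key u := by
        intro u hu
        by_cases h : u = root
        · rw [h]; exact hmax v hvW
        · exact hmin u (Finset.mem_erase.2 ⟨h, hu⟩)
      obtain ⟨w, hwW, hvw, hw⟩ := hdom v hvW hvr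
      have hvw' : v ≠ w := by rintro rfl; exact lt_irrefl _ hvw
      have hwd : ∀ u ∈ W, adj v u → adj w u := fun u hu => hw u hu (hmin' u hu)
      have hac : Acyc adj (W.erase v) := by
        apply ih
        · rw [Finset.card_erase_of_mem hvW, hW]; rfl
        · exact Finset.mem_erase.2 ⟨Ne.symm hvr, hroot⟩
        · exact fun u hu => hmax u (Finset.mem_of_mem_erase hu)
        · intro x hx hxr
          obtain ⟨y, hy, hxy, hy2⟩ := hdom x (Finset.mem_of_mem_erase hx) hxr
          refine ⟨y, Finset.mem_erase.2 ⟨?_, hy⟩, hxy, fun u hu => hy2 u (Finset.mem_of_mem_erase hu)⟩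
          rintro rfl
          exact absurd (hmin' x (Finset.mem_of_mem_erase hx)) (not_le.2 hxy)
      intro n c hc hbc
      have hphi := phi_eq v w hvw' c
      rw [hbc, map_zero, add_zero] at hphi
      have hcl : ∀ σ ∈ KK adj W n, v ∈ σ → ∀ u ∈ insert w σ, ∀ x ∈ insert w σ, adj u x := by
        rintro σ ⟨h1, h2, h3⟩ hvσ u hu x hx
        rcases Finset.mem_insert.1 hu with hu' | hu' <;>
          rcases Finset.mem_insert.1 hx with hx' | hx'
        · rw [hu', hx']; exact hr _
        · rw [hu']; exact hwd _ (h1 hx') (h3 _ hvσ _ hx')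
        · rw [hx']; exact hs _ _ (hwd _ (h1 hu') (h3 _ hvσ _ hu'))
        · exact h3 _ hu' _ hx'
      have h1 : phi v w c ∈ Sp adj (W.erase v) n := by
        refine sp_map _ _ ?_ c hc
        intro σ hσ
        have hcl' := hcl σ hσ
        obtain ⟨h1, h2, h3⟩ := hσ
        rw [phi_S]
        by_cases a : v ∉ σ
        · rw [if_pos a]
          apply S_mem
          refine ⟨fun x hx => Finset.mem_erase.2 ⟨?_, h1 hx⟩, h2, h3⟩
          rintro rfl; exact a hx
        rw [if_neg a]
        have a' : v ∈ σ := by simpa using a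
        by_cases b : w ∈ σ
        · rw [if_pos b]
          exact Submodule.zero_mem _
        · rw [if_neg b]
          apply S_mem
          refine ⟨?_, ?_, ?_⟩
          · intro x hx
            rcases Finset.mem_insert.1 hx with rfl | hx
            · exact Finset.mem_erase.2 ⟨Ne.symm hvw', hwW⟩
            · exact Finset.erase_subset_erase _ h1 hx
          · rw [Finset.card_insert_of_notMem (by simp [b]), Finset.card_erase_of_mem a']
            have := Finset.card_pos.2 ⟨v, a'⟩
            omega
          · intro u hu x hx
            apply hcl' a'
            · exact Finset.insert_subset_insert _ (Finset.erase_subset _ _) hu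
            · exact Finset.insert_subset_insert _ (Finset.erase_subset _ _) hx
      have h2 : hh v w c ∈ Sp adj W (n+1) := by
        refine sp_map _ _ ?_ c hc
        intro σ hσ
        have hcl' := hcl σ hσ
        obtain ⟨h1, h2, h3⟩ := hσ
        rw [hh_S]
        split_ifs with a
        · apply S_mem
          refine ⟨Finset.insert_subset hwW h1, ?_, hcl' a.1⟩
          rw [Finset.card_insert_of_notMem a.2, h2]
        · exact Submodule.zero_mem _
      have h3 : bd (phi v w c) = 0 := by
        rw [← hphi, map_add, hbc, bd_bd, add_zero]
      obtain ⟨d, hd, hd2⟩ := hac n _ h1 h3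
      refine ⟨d + hh v w c, Submodule.add_mem _ ?_ h2, ?_⟩
      · refine Finsupp.supported_mono ?_ hd
        rintro σ ⟨h1, h2, h3⟩
        exact ⟨h1.trans (Finset.erase_subset _ _), h2, h3⟩
      · rw [map_add, hd2, ← hphi, add_assoc, add_self', add_zero]
    · intro n c hc hbc
      have hW1 : ∀ x ∈ W, x = root := by
        intro x hx
        by_contra h
        exact hne ⟨x, Finset.mem_erase.2 ⟨h, hx⟩⟩
      have := cone_bd root c
      rw [hbc, map_zero, add_zero] at this
      refine ⟨cone root c, ?_, this⟩
      refine sp_map _ _ ?_ c hc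
      rintro σ ⟨h1, h2, h3⟩
      rw [cone_S]
      split_ifs with a
      · exact Submodule.zero_mem _
      · apply S_mem
        have hsub : insert root σ ⊆ W := Finset.insert_subset hroot h1
        refine ⟨hsub, by rw [Finset.card_insert_of_notMem a, h2], ?_⟩
        intro u hu x hx
        rw [hW1 u (hsub hu), hW1 x (hsub hx)]
        exact hr _


/-- alternating indicator -/
def al : ℕ → Bool → Finset (ℕ × Bool) → ZMod 2
  | 0, _, _ => 1
  | K+1, b, T => if (K, b) ∈ T then al K (!b) T else if (K, !b) ∈ T then 0 else al K b T

lemma al_empty (K : ℕ) (b : Bool) : al K b ∅ = 1 := by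
  induction K generalizing b with
  | zero => rfl
  | succ K ih => simp [al, ih]

lemma al_erase (K : ℕ) (b : Bool) (T : Finset (ℕ × Bool)) (t : ℕ × Bool) (ht : K ≤ t.1) :
    al K b (T.erase t) = al K b T := by
  induction K generalizing b with
  | zero => rfl
  | succ K ih =>
    have h : ∀ b', (K, b') ≠ t := by rintro b' rfl; simp at ht
    simp only [al, Finset.mem_erase, ih _ (by omega : K ≤ t.1)]
    simp [h]

lemma al_sum (K : ℕ) (b : Bool) (T : Finset (ℕ × Bool)) (hT : ∀ j, (j, true) ∈ T → (j, false) ∉ T) :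
    ∑ t ∈ T with t.1 < K, al K b (T.erase t) = al K b T + al K (!b) T := by
  induction K generalizing b with
  | zero => simp [al]; decide
  | succ K ih =>
    have hsplit : ∀ f : ℕ × Bool → ZMod 2, ∑ t ∈ T with t.1 < K + 1, f t
        = ∑ t ∈ T with t.1 < K, f t + ∑ t ∈ T with t.1 = K, f t := by
      intro f
      rw [← Finset.sum_union]
      · congr 1
        ext t
        simp only [Finset.mem_filter, Finset.mem_union]
        constructor
        · rintro ⟨h1, h2⟩
          rcases Nat.lt_succ_iff_lt_or_eq.1 h2 with h | h
          · exact Or.inl ⟨h1, h⟩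
          · exact Or.inr ⟨h1, h⟩
        · rintro (⟨h1, h2⟩ | ⟨h1, h2⟩)
          · exact ⟨h1, by omega⟩
          · exact ⟨h1, by omega⟩
      · rw [Finset.disjoint_filter]
        intro t _ h1 h2
        omega
    rw [hsplit]
    have hmem : ∀ b', ∀ t ∈ T.filter (fun t => t.1 < K), ((K, b') ∈ T.erase t ↔ (K, b') ∈ T) := by
      intro b' t ht
      rw [Finset.mem_erase]
      have : (K, b') ≠ t := by
        rintro rfl
        simp at ht
      simp [this]
    have hT' : ∀ b, (K, b) ∈ T → (K, !b) ∉ T := by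
      intro b hb
      cases b
      · exact fun h => hT K h hb
      · exact hT K hb
    have h2 : ∀ z : ZMod 2, z + z = 0 := CharTwo.add_self_eq_zero
    by_cases h1 : (K, b) ∈ T
    · have hf : T.filter (fun t => t.1 = K) = {(K, b)} := by
        ext ⟨j, b'⟩
        simp only [Finset.mem_filter, Finset.mem_singleton, Prod.mk.injEq]
        constructor
        · rintro ⟨h, rfl⟩
          refine ⟨rfl, ?_⟩
          by_contra hne
          have : b' = !b := by cases b <;> cases b' <;> simp_all
          rw [this] at h
          exact hT' b h1 h
        · rintro ⟨rfl, rfl⟩; exact ⟨h1, rfl⟩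
      rw [hf, Finset.sum_singleton]
      have e1 : ∑ t ∈ T with t.1 < K, al (K+1) b (T.erase t) =
          ∑ t ∈ T with t.1 < K, al K (!b) (T.erase t) := by
        apply Finset.sum_congr rfl
        intro t ht
        simp only [al]
        rw [if_pos ((hmem b t ht).2 h1)]
      rw [e1, ih]
      have e2 : al (K+1) b (T.erase (K, b)) = al K b T := by
        simp only [al]
        rw [if_neg (by simp), if_neg (by simp [hT' b h1]), al_erase _ _ _ _ (by simp)]
      rw [e2]
      have e3 : al (K+1) b T = al K (!b) T := by
        simp only [al]; rw [if_pos h1]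
      have e4 : al (K+1) (!b) T = 0 := by
        simp only [al]; rw [if_neg (hT' b h1), if_pos (by simpa using h1)]
      rw [e3, e4, Bool.not_not, add_assoc, h2]
    · by_cases h3 : (K, !b) ∈ T
      · have hf : T.filter (fun t => t.1 = K) = {(K, !b)} := by
          ext ⟨j, b'⟩
          simp only [Finset.mem_filter, Finset.mem_singleton, Prod.mk.injEq]
          constructor
          · rintro ⟨h, rfl⟩
            refine ⟨rfl, ?_⟩
            by_contra hne
            have : b' = b := by cases b <;> cases b' <;> simp_all
            rw [this] at h
            exact h1 h
          · rintro ⟨rfl, rfl⟩; exact ⟨h3, rfl⟩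
        rw [hf, Finset.sum_singleton]
        have e1 : ∑ t ∈ T with t.1 < K, al (K+1) b (T.erase t) = 0 := by
          apply Finset.sum_eq_zero
          intro t ht
          simp only [al]
          rw [if_neg (fun h => h1 ((hmem b t ht).1 h)), if_pos ((hmem _ t ht).2 h3)]
        have e2 : al (K+1) b (T.erase (K, !b)) = al K b T := by
          simp only [al]
          rw [if_neg (by simp [h1]), if_neg (by simp), al_erase _ _ _ _ (by simp)]
        have e3 : al (K+1) b T = 0 := by
          simp only [al]; rw [if_neg h1, if_pos h3]
        have e4 : al (K+1) (!b) T = al K b T := by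
          simp only [al]; rw [if_pos h3, Bool.not_not]
        rw [e1, e2, e3, e4]
      · have hf : T.filter (fun t => t.1 = K) = ∅ := by
          ext ⟨j, b'⟩
          simp only [Finset.mem_filter, Finset.notMem_empty, iff_false]
          rintro ⟨h, rfl⟩
          cases b <;> cases b' <;> simp_all
        rw [hf, Finset.sum_empty, add_zero]
        have e1 : ∑ t ∈ T with t.1 < K, al (K+1) b (T.erase t) =
            ∑ t ∈ T with t.1 < K, al K b (T.erase t) := by
          apply Finset.sum_congr rfl
          intro t ht
          simp only [al]
          rw [if_neg (fun h => h1 ((hmem b t ht).1 h)), if_neg (fun h => h3 ((hmem _ t ht).1 h))]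
        have e3 : al (K+1) b T = al K b T := by
          simp only [al]; rw [if_neg h1, if_neg h3]
        have e4 : al (K+1) (!b) T = al K (!b) T := by
          simp only [al]; rw [if_neg h3, if_neg (by simpa using h1)]
        rw [e1, ih, e3, e4]

lemma al_neg (K : ℕ) (b : Bool) (T T' : Finset (ℕ × Bool))
    (h : ∀ j b, (j, b) ∈ T' ↔ (j, !b) ∈ T) : al K b T' = al K (!b) T := by
  induction K generalizing b with
  | zero => rfl
  | succ K ih =>
    simp only [al, h, ih]

def aS (lam : X → ℕ × Bool) (K : ℕ) (b : Bool) (σ : Finset X) : ZMod 2 :=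
  if (σ.image lam).card = σ.card then al K b (σ.image lam) else 0

noncomputable def aa (lam : X → ℕ × Bool) (K : ℕ) (b : Bool) : Ch X →ₗ[ZMod 2] ZMod 2 :=
  Finsupp.linearCombination (ZMod 2) (aS lam K b)

lemma aa_S (lam : X → ℕ × Bool) (K : ℕ) (b : Bool) (σ : Finset X) :
    aa lam K b (S σ) = aS lam K b σ := by
  simp [aa, S]

lemma aS_sum (lam : X → ℕ × Bool) (K : ℕ) (b : Bool) (σ : Finset X)
    (hK : ∀ x ∈ σ, (lam x).1 < K)
    (hc : ∀ x ∈ σ, ∀ y ∈ σ, (lam x).1 = (lam y).1 → lam x = lam y) :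
    ∑ v ∈ σ, aS lam K b (σ.erase v) = aS lam K b σ + aS lam K (!b) σ := by
  by_cases hinj : Set.InjOn lam σ
  · have e0 : (σ.image lam).card = σ.card := Finset.card_image_of_injOn hinj
    have e1 : ∀ v ∈ σ, aS lam K b (σ.erase v) = al K b ((σ.image lam).erase (lam v)) := by
      intro v hv
      have h1 : (σ.erase v).image lam = (σ.image lam).erase (lam v) := by
        ext t
        simp only [Finset.mem_image, Finset.mem_erase]
        constructor
        · rintro ⟨x, ⟨h1, h2⟩, rfl⟩
          exact ⟨fun h => h1 (hinj h2 hv h), x, h2, rfl⟩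
        · rintro ⟨h1, x, h2, rfl⟩
          exact ⟨x, ⟨fun h => h1 (by rw [h]), h2⟩, rfl⟩
      have h2 : ((σ.erase v).image lam).card = (σ.erase v).card :=
        Finset.card_image_of_injOn (hinj.mono (by simp))
      unfold aS
      rw [if_pos h2, h1]
    rw [Finset.sum_congr rfl e1, ← Finset.sum_image (f := fun t => al K b ((σ.image lam).erase t)) hinj]
    unfold aS
    rw [if_pos e0, if_pos e0, ← al_sum]
    · apply Finset.sum_congr _ (fun _ _ => rfl)
      ext t
      simp only [Finset.mem_filter, Finset.mem_image]
      constructor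
      · rintro ⟨x, hx, rfl⟩; exact ⟨⟨x, hx, rfl⟩, hK x hx⟩
      · exact fun h => h.1
    · intro j h1 h2
      obtain ⟨x, hx, hx2⟩ := Finset.mem_image.1 h1
      obtain ⟨y, hy, hy2⟩ := Finset.mem_image.1 h2
      have := hc x hx y hy (by rw [hx2, hy2])
      rw [hx2, hy2] at this
      simp at this
  · have hne : ∀ τ : Finset X, ¬ Set.InjOn lam τ → ∀ b, aS lam K b τ = 0 := by
      intro τ hτ b
      unfold aS
      rw [if_neg]
      exact fun h => hτ (Finset.card_image_iff.1 h)
    rw [hne σ hinj, hne σ hinj, add_zero]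
    unfold Set.InjOn at hinj
    push Not at hinj
    obtain ⟨v, hv, w, hw, hvw, hne'⟩ := hinj
    have hv' : v ∈ σ := hv
    have hw' : w ∈ σ := hw
    rw [← Finset.add_sum_erase _ _ hv', ← Finset.add_sum_erase _ _ (Finset.mem_erase.2 ⟨Ne.symm hne', hw'⟩),
      Finset.sum_eq_zero, add_zero]
    · have him : ∀ v w, v ∈ σ → w ∈ σ → v ≠ w → lam v = lam w →
          (σ.erase v).image lam = σ.image lam := by
        intro v w hv hw hne h
        apply Finset.Subset.antisymm (Finset.image_subset_image (Finset.erase_subset _ _))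
        intro t ht
        obtain ⟨x, hx, rfl⟩ := Finset.mem_image.1 ht
        by_cases hxv : x = v
        · rw [hxv, h]
          exact Finset.mem_image_of_mem _ (Finset.mem_erase.2 ⟨Ne.symm hne, hw⟩)
        · exact Finset.mem_image_of_mem _ (Finset.mem_erase.2 ⟨hxv, hx⟩)
      have : aS lam K b (σ.erase v) = aS lam K b (σ.erase w) := by
        unfold aS
        rw [him v w hv' hw' hne' hvw, him w v hw' hv' (Ne.symm hne') hvw.symm,
          Finset.card_erase_of_mem hv', Finset.card_erase_of_mem hw']
      rw [this]
      exact CharTwo.add_self_eq_zero _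
    · intro x hx
      apply hne
      intro h
      simp only [Finset.mem_erase] at hx
      exact hne' (h (by simp [hv', Ne.symm hx.2.1]) (by simp [hw', Ne.symm hx.1]) hvw)

noncomputable def nu (ν : X → X) : Ch X →ₗ[ZMod 2] Ch X :=
  Finsupp.linearCombination (ZMod 2) (fun σ : Finset X => S (σ.image ν))

lemma nu_S (ν : X → X) (σ : Finset X) : nu ν (S σ) = S (σ.image ν) := by
  simp [nu, S]

lemma nu_nu (ν : X → X) (hν : Function.Involutive ν) (c : Ch X) : nu ν (nu ν c) = c := by
  have : nu ν ∘ₗ nu ν = LinearMap.id := lin_ext _ _ (fun σ => by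
    simp only [LinearMap.comp_apply, nu_S, Finset.image_image, hν.comp_self, Finset.image_id,
      LinearMap.id_apply])
  simpa using congrArg (fun f => f c) this

lemma nu_bd (ν : X → X) (hν : Function.Involutive ν) (c : Ch X) : bd (nu ν c) = nu ν (bd c) := by
  have : bd ∘ₗ nu ν = nu ν ∘ₗ bd := lin_ext _ _ (fun σ => by
    simp only [LinearMap.comp_apply, nu_S, bd_S, map_sum]
    rw [Finset.sum_image hν.injective.injOn]
    refine Finset.sum_congr rfl fun v _ => ?_
    rw [Finset.image_erase hν.injective])
  simpa using congrArg (fun f => f c) this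

lemma eq_of_sp {s : Set (Finset X)} (f g : Ch X →ₗ[ZMod 2] ZMod 2)
    (h : ∀ σ ∈ s, f (S σ) = g (S σ)) (c : Ch X) (hc : c ∈ Finsupp.supported (ZMod 2) (ZMod 2) s) :
    f c = g c := by
  have := sp_map ⊥ (f - g) (s := s) (by intro σ hσ; simp [h σ hσ]) c hc
  simpa [sub_eq_zero] using this

theorem fan (ν : X → X) (hν : Function.Involutive ν) (adj : X → X → Prop)
    (hr : ∀ x, adj x x) (hadj : ∀ x y, adj x y → adj (ν x) (ν y))
    (K : ℕ) (H : ℕ → Finset X) (hH0 : (H 0).Nonempty) (hH : ∀ i ≤ K, Acyc adj (H i))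
    (hHs : ∀ i < K, H i ⊆ H (i+1)) (hHν : ∀ i < K, ∀ x ∈ H i, ν x ∈ H (i+1))
    (lam : X → ℕ × Bool) (hK : ∀ x, (lam x).1 < K)
    (hlν : ∀ x, lam (ν x) = ((lam x).1, !(lam x).2))
    (hcomp : ∀ x y, adj x y → (lam x).1 = (lam y).1 → lam x = lam y) : False := by
  have hmain : ∀ i ≤ K, ∃ e ∈ Sp adj (H i) (i+1), (∀ b, aa lam K b e + aa lam K (!b) e = 1) ∧
      bd (e + nu ν e) = 0 := by
    intro i
    induction i with
    | zero =>
      intro _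
      obtain ⟨x, hx⟩ := hH0
      refine ⟨S {x}, S_mem ⟨by simpa using hx, by simp, by simp [hr]⟩, ?_, ?_⟩
      · intro b
        rw [aa_S, aa_S, ← aS_sum]
        · simp [aS, al_empty]
        · simp [hK]
        · simp
      · rw [nu_S, map_add, bd_S, bd_S]
        simp only [Finset.image_singleton, Finset.sum_singleton, Finset.erase_singleton]
        exact add_self' _
    | succ i ih =>
      intro hi
      obtain ⟨e, he, hea, heb⟩ := ih (by omega)
      have h1 : e + nu ν e ∈ Sp adj (H (i+1)) (i+1) := by
        apply Submodule.add_mem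
        · refine Finsupp.supported_mono ?_ he
          rintro σ ⟨h1, h2, h3⟩
          exact ⟨h1.trans (hHs i (by omega)), h2, h3⟩
        · refine sp_map _ _ ?_ e he
          rintro σ ⟨h1, h2, h3⟩
          rw [nu_S]
          apply S_mem
          refine ⟨?_, ?_, ?_⟩
          · intro y hy
            obtain ⟨x, hx, rfl⟩ := Finset.mem_image.1 hy
            exact hHν i (by omega) x (h1 hx)
          · rw [Finset.card_image_of_injective _ hν.injective, h2]
          · intro u hu v hv
            obtain ⟨x, hx, rfl⟩ := Finset.mem_image.1 hu
            obtain ⟨y, hy, rfl⟩ := Finset.mem_image.1 hv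
            exact hadj _ _ (h3 x hx y hy)
      obtain ⟨d, hd, hd2⟩ := hH (i+1) hi _ _ h1 heb
      refine ⟨d, hd, ?_, ?_⟩
      · intro b
        have e1 : (aa lam K b + aa lam K (!b)) d = (aa lam K b ∘ₗ bd) d := by
          refine eq_of_sp _ _ ?_ d hd
          rintro σ ⟨h1, h2, h3⟩
          simp only [LinearMap.add_apply, LinearMap.comp_apply, bd_S, map_sum, aa_S]
          rw [aS_sum]
          · exact fun x _ => hK x
          · exact fun x hx y hy => hcomp x y (h3 x hx y hy)
        have e2 : aa lam K b ∘ₗ nu ν = aa lam K (!b) := by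
          refine lin_ext _ _ fun σ => ?_
          simp only [LinearMap.comp_apply, nu_S, aa_S]
          unfold aS
          rw [Finset.card_image_of_injective _ hν.injective]
          have hn : ∀ j b, (j, b) ∈ (σ.image ν).image lam ↔ (j, !b) ∈ σ.image lam := by
            intro j b
            simp only [Finset.mem_image, exists_exists_and_eq_and, hlν]
            constructor
            · rintro ⟨x, hx, h⟩
              refine ⟨x, hx, ?_⟩
              rw [Prod.mk.injEq] at h
              rw [← h.1, ← h.2, Bool.not_not]
            · rintro ⟨x, hx, h⟩
              refine ⟨x, hx, ?_⟩
              rw [h]; simp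
          have hcard : ((σ.image ν).image lam).card = (σ.image lam).card := by
            have hinj : Function.Injective (fun t : ℕ × Bool => (t.1, !t.2)) := by
              rintro ⟨a, b⟩ ⟨c, d⟩ h
              simpa using h
            rw [← Finset.card_image_of_injective (σ.image lam) hinj]
            congr 1
            rw [Finset.image_image, Finset.image_image]
            apply Finset.image_congr
            intro x _
            simp [hlν]
          rw [hcard, al_neg K b _ _ hn]
        have e3 := congrArg (fun f => f e) e2
        simp only [LinearMap.comp_apply] at e3
        rw [LinearMap.add_apply, LinearMap.comp_apply, hd2, map_add, e3, hea] at e1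
        exact e1
      · rw [map_add, nu_bd ν hν, hd2, map_add, nu_nu ν hν, add_comm (nu ν e) e]
        exact add_self' _
  obtain ⟨e, he, hea, _⟩ := hmain K le_rfl
  have h0 : ∀ b, aa lam K b e = 0 := by
    intro b
    refine eq_of_sp (aa lam K b) 0 ?_ e he
    rintro σ ⟨h1, h2, h3⟩
    rw [aa_S]
    unfold aS
    rw [if_neg, LinearMap.zero_apply]
    intro h
    have hinj : Set.InjOn (Prod.fst : ℕ × Bool → ℕ) (↑(σ.image lam) : Set (ℕ × Bool)) := by
      intro s hs t ht hst
      obtain ⟨x, hx, rfl⟩ := Finset.mem_image.1 hs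
      obtain ⟨y, hy, rfl⟩ := Finset.mem_image.1 ht
      exact hcomp x y (h3 x hx y hy) hst
    have hc1 := Finset.card_image_of_injOn hinj
    have hsub : (σ.image lam).image Prod.fst ⊆ Finset.range K := by
      intro j hj
      obtain ⟨t, ht, rfl⟩ := Finset.mem_image.1 hj
      obtain ⟨x, hx, rfl⟩ := Finset.mem_image.1 ht
      exact Finset.mem_range.2 (hK x)
    have := Finset.card_le_card hsub
    rw [Finset.card_range] at this
    omega
  have := hea true
  rw [h0, h0] at this
  simp at this

end Fan

namespace Cube
open Finset

/-- lattice points on the boundary of the cube -/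
def V (D m : ℕ) : Type := {x : Fin D → ℤ // (∀ i, |x i| ≤ m) ∧ ∃ i, |x i| = m}

variable {D m : ℕ}

noncomputable instance : DecidableEq (V D m) := Classical.decEq _

def toBox (x : V D m) : Fin D → Finset.Icc (-(m:ℤ)) m :=
  fun i => ⟨x.1 i, Finset.mem_Icc.2 (abs_le.1 (x.2.1 i))⟩

lemma toBox_inj : Function.Injective (toBox : V D m → _) := by
  intro x y h
  apply Subtype.ext
  funext i
  have := congrFun h i
  exact congrArg Subtype.val this

noncomputable instance : Fintype (V D m) := Fintype.ofInjective _ toBox_inj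

lemma card_V : Fintype.card (V D m) ≤ (2 * m + 1) ^ D := by
  have h := Fintype.card_le_of_injective _ (toBox_inj (D := D) (m := m))
  rw [Fintype.card_fun, Fintype.card_coe, Int.card_Icc, Fintype.card_fin] at h
  have : ((m:ℤ) + 1 - -(m:ℤ)).toNat = 2 * m + 1 := by omega
  rwa [this] at h

def neg (x : V D m) : V D m := ⟨fun i => - x.1 i, by simpa using x.2.1, by simpa using x.2.2⟩

def near (x y : V D m) : Prop := ∀ i, |x.1 i - y.1 i| ≤ 1

def G (D m : ℕ) (hm : 2 ≤ m) : SimpleGraph (V D m) where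
  Adj x y := ∀ i, |x.1 i + y.1 i| ≤ 1
  symm := ⟨fun x y h i => by rw [add_comm]; exact h i⟩
  loopless := ⟨fun x h => by
    obtain ⟨i, hi⟩ := x.2.2
    have := h i
    rw [← two_mul, abs_mul, hi] at this
    simp at this
    omega⟩

lemma G_cliqueFree (hm : 2 ≤ m) : (G D m hm).CliqueFree 3 := by
  intro s hs
  rw [SimpleGraph.is3Clique_iff] at hs
  obtain ⟨x, y, z, hxy, hxz, hyz, -⟩ := hs
  obtain ⟨i, hi⟩ := x.2.2
  have h1 := abs_le.1 (hxy i)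
  have h2 := abs_le.1 (hxz i)
  have h3 := abs_le.1 (hyz i)
  rcases abs_choice (x.1 i) with h | h <;> omega

lemma G_colorable (hm : 2 ≤ m) : (G D m hm).Colorable (D+1) := by
  classical
  refine ⟨SimpleGraph.Coloring.mk (fun x : V D m => if h : ∃ i, 0 < x.1 i then (h.choose).castSucc else Fin.last D) ?_⟩
  intro x y hxy heq
  by_cases hx : ∃ i, 0 < x.1 i <;> by_cases hy : ∃ i, 0 < y.1 i
  · simp only [hx, hy, dif_pos] at heq
    have e := Fin.castSucc_injective _ heq
    have h1 := hx.choose_spec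
    have h2 := hy.choose_spec
    rw [← e] at h2
    have := abs_le.1 (hxy hx.choose)
    omega
  · simp only [hx, hy, dif_pos] at heq
    exact absurd heq (Fin.castSucc_lt_last _).ne
  · simp only [hx, hy, dif_pos] at heq
    exact absurd heq.symm (Fin.castSucc_lt_last _).ne
  · push Not at hx hy
    obtain ⟨i, hi⟩ := x.2.2
    have h1 := hx i
    have h2 := hy i
    have := abs_le.1 (hxy i)
    rw [abs_of_nonpos h1] at hi
    omega

lemma two_col (hm : 2 ≤ m) (c : ℕ) (hc : c < m) (W : Set (V D m))
    (hW : ∀ x ∈ W, ∀ i, |x.1 i| ≠ c) : ((G D m hm).induce W).Colorable 2 := by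
  classical
  have hex : ∀ x : V D m, ∃ i, (c:ℤ) < |x.1 i| := by
    intro x
    obtain ⟨i, hi⟩ := x.2.2
    exact ⟨i, by rw [hi]; exact_mod_cast hc⟩
  have hfin : ∀ x : V D m, ∃ i, (c:ℤ) < |x.1 i| ∧ ∀ j < i, ¬ (c:ℤ) < |x.1 j| := by
    intro x
    obtain ⟨i, hi, hmin⟩ := WellFounded.has_min (wellFounded_lt (α := Fin D)) {i | (c:ℤ) < |x.1 i|} (hex x)
    exact ⟨i, hi, fun j hj h => hmin j h hj⟩
  choose f hf1 hf2 using hfin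
  let col : W → Bool := fun x => decide (0 < x.1.1 (f x.1))
  have hcol : ∀ x y : W, ((G D m hm).induce W).Adj x y → col x ≠ col y := by
    rintro ⟨x, hx⟩ ⟨y, hy⟩ hxy heq
    have hxy' : ∀ i, |x.1 i + y.1 i| ≤ 1 := hxy
    have key : ∀ x y : V D m, x ∈ W → y ∈ W → (∀ i, |x.1 i + y.1 i| ≤ 1) →
        ∀ i, (c:ℤ) < |x.1 i| → (c:ℤ) < |y.1 i| := by
      intro x y hx hy h i hi
      have h1 := abs_le.1 (h i)
      have h2 := hW y hy i
      rcases abs_cases (x.1 i) with h3 | h3 <;> rcases abs_cases (y.1 i) with h4 | h4 <;> omega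
    have hfe : f x = f y := by
      apply le_antisymm
      · by_contra h
        push Not at h
        exact hf2 x _ h (key y x hy hx (fun i => by rw [add_comm]; exact hxy' i) _ (hf1 y))
      · by_contra h
        push Not at h
        exact hf2 y _ h (key x y hx hy hxy' _ (hf1 x))
    simp only [col, hfe, decide_eq_decide] at heq
    have a1 := hf1 x
    have a2 := hf1 y
    rw [hfe] at a1
    have a3 := abs_le.1 (hxy' (f y))
    rcases abs_cases (x.1 (f y)) with h3 | h3 <;> rcases abs_cases (y.1 (f y)) with h4 | h4 <;> omega
  have := SimpleGraph.Coloring.colorable (SimpleGraph.Coloring.mk col (fun {a b} h => hcol a b h))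
  simpa using this

/-- hemispheres -/
noncomputable def H (K m i : ℕ) : Finset (V (K+1) m) :=
  {x | (∀ j : Fin (K+1), j.val + i < K → x.1 j = 0) ∧ ∀ j : Fin (K+1), j.val + i = K → 0 ≤ x.1 j}

lemma mem_H {K m i : ℕ} (x : V (K+1) m) : x ∈ H K m i ↔
    (∀ j : Fin (K+1), j.val + i < K → x.1 j = 0) ∧ ∀ j : Fin (K+1), j.val + i = K → 0 ≤ x.1 j := by
  simp [H]

lemma H_acyc (K m i : ℕ) (hm : 2 ≤ m) (hi : i ≤ K) : Fan.Acyc near (H K m i) := by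
  classical
  let root : V (K+1) m := ⟨fun j => if j.val + i < K then 0 else m, by
    refine ⟨fun j => ?_, ⟨⟨K, by omega⟩, ?_⟩⟩
    · beta_reduce; split_ifs <;> simp
    · simp⟩
  have hroot : root ∈ H K m i := by
    rw [mem_H]
    refine ⟨fun j hj => by simp [root, hj], fun j hj => by simp [root, hj]⟩
  refine Fan.acyc_dism (fun x => toLex x.1) near (by intro x j; simp)
    (by intro x y h j; rw [abs_sub_comm]; exact h j) root _ _ rfl hroot ?_ ?_
  · intro u hu
    apply Pi.toLex_monotone
    intro j
    rw [mem_H] at hu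
    by_cases h : j.val + i < K
    · simp [root, h, hu.1 j h]
    · simp only [root, h, if_false]
      exact (abs_le.1 (u.2.1 j)).2
  · intro v hv hvr
    rw [mem_H] at hv
    have hex : ∃ j, v.1 j < root.1 j := by
      by_contra hcon
      push Not at hcon
      apply hvr
      apply Subtype.ext
      funext j
      apply le_antisymm _ (hcon j)
      by_cases h : j.val + i < K
      · simp [root, h, hv.1 j h]
      · simp only [root, h, if_false]
        exact (abs_le.1 (v.2.1 j)).2
    obtain ⟨j, hj, hmin⟩ := WellFounded.has_min (wellFounded_lt (α := Fin (K+1)))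
      {j | v.1 j < root.1 j} hex
    have hj' : v.1 j < root.1 j := hj
    have hji : ¬ j.val + i < K := by
      intro h
      simp [root, h, hv.1 j h] at hj'
    have hjm : v.1 j < m := by simpa [root, hji] using hj'
    have hlow : ∀ l < j, ¬ l.val + i < K → v.1 l = m := by
      intro l hl hlK
      have := hmin l
      have h1 : ¬ v.1 l < root.1 l := fun h => hmin l h hl
      simp only [root, hlK, if_false] at h1
      have := (abs_le.1 (v.2.1 l)).2
      omega
    let w : V (K+1) m := ⟨fun l => if l = j then v.1 j + 1 else v.1 l, by
      refine ⟨fun l => ?_, ?_⟩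
      · beta_reduce
        split_ifs
        · have := abs_le.1 (v.2.1 j)
          rw [abs_le]; omega
        · exact v.2.1 l
      · by_cases hjK : j.val + i = K
        · obtain ⟨l, hl⟩ := v.2.2
          refine ⟨l, ?_⟩
          have : l ≠ j := by
            rintro rfl
            have := hv.2 _ hjK
            rw [abs_of_nonneg this] at hl
            omega
          simp [this, hl]
        · refine ⟨⟨K - i, by omega⟩, ?_⟩
          have hlt : (⟨K - i, by omega⟩ : Fin (K+1)) < j := by
            rw [Fin.lt_def]; simp; omega
          have := hlow _ hlt (by simp; omega)
          simp [hlt.ne, this]⟩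
    have hwj : w.1 j = v.1 j + 1 := by simp [w]
    have hwl : ∀ l, l ≠ j → w.1 l = v.1 l := by intro l hl; simp [w, hl]
    refine ⟨w, ?_, ?_, ?_⟩
    · rw [mem_H]
      refine ⟨fun l hl => ?_, fun l hl => ?_⟩
      · rw [hwl l (by rintro rfl; exact hji hl)]
        exact hv.1 l hl
      · by_cases h : l = j
        · subst h; rw [hwj]; have := hv.2 _ hl; omega
        · rw [hwl l h]; exact hv.2 l hl
    · refine ⟨j, fun l hl => ?_, ?_⟩
      · exact (hwl l hl.ne).symm
      · change v.1 j < w.1 j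
        omega
    · intro u hu hvu hadj l
      by_cases h : l = j
      · subst h
        rw [hwj]
        have h1 := abs_le.1 (hadj l)
        have h2 : v.1 l ≤ u.1 l := by
          rcases hvu.eq_or_lt with he | hlt
          · have : v.1 = u.1 := he
            rw [this]
          · obtain ⟨p, hp1, hp2⟩ := hlt
            have hp1' : ∀ q < p, v.1 q = u.1 q := hp1
            have hp2' : v.1 p < u.1 p := hp2
            rcases lt_trichotomy p l with h3 | h3 | h3
            · exfalso
              by_cases h4 : p.val + i < K
              · rw [hv.1 p h4, ((mem_H u).1 hu).1 p h4] at hp2'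
                exact lt_irrefl _ hp2'
              · rw [hlow p h3 h4] at hp2'
                have := (abs_le.1 (u.2.1 p)).2
                omega
            · subst h3; exact hp2'.le
            · exact (hp1' l h3).le
        rw [abs_le]; omega
      · rw [hwl l h]; exact hadj l

lemma G_not_colorable (K : ℕ) (hm : 2 ≤ m) : ¬ (G (K+1) m hm).Colorable (K+1) := by
  rintro ⟨C⟩
  have hadj : ∀ x y : V (K+1) m, near x y → C x ≠ C (neg y) := by
    intro x y h
    apply C.valid
    intro i
    have := h i
    simpa [neg, sub_eq_add_neg] using this
  have hr : ∀ x : V (K+1) m, near x x := by intro x j; simp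
  have hneg : Function.Involutive (neg : V (K+1) m → _) := by
    intro x; apply Subtype.ext; funext i; simp [neg]
  have hns : ∀ x y : V (K+1) m, near x y → near (neg x) (neg y) := by
    intro x y h i
    have := abs_le.1 (h i)
    simp only [neg]
    rw [abs_le]; omega
  refine Fan.fan neg hneg near hr hns K (H K m) ?_ (fun i hi => H_acyc K m i hm hi) ?_ ?_
    (fun x => if (C x).val < (C (neg x)).val then ((C x).val, true) else ((C (neg x)).val, false))
    ?_ ?_ ?_
  · refine ⟨(⟨fun j => if j.val = K then m else 0, ?_, ⟨⟨K, by omega⟩, by simp⟩⟩ : V (K+1) m), ?_⟩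
    · intro j; beta_reduce; split_ifs <;> simp
    · refine (mem_H _).2 ?_
      refine ⟨fun j hj => ?_, fun j hj => ?_⟩
      · have : j.val ≠ K := by omega
        simp [this]
      · have : j.val = K := by omega
        simp [this]
  · intro i hi x hx
    rw [mem_H] at hx ⊢
    exact ⟨fun j hj => hx.1 j (by omega), fun j hj => (hx.1 j (by omega)).ge⟩
  · intro i hi x hx
    rw [mem_H] at hx ⊢
    exact ⟨fun j hj => by simp [neg, hx.1 j (by omega)], fun j hj => by simp [neg, hx.1 j (by omega)]⟩
  · intro x
    have h1 := (C x).2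
    have h2 := (C (neg x)).2
    have h3 : (C x).val ≠ (C (neg x)).val := fun h => hadj x x (hr x) (Fin.ext h)
    split_ifs <;> simp <;> omega
  · intro x
    have h3 : (C x).val ≠ (C (neg x)).val := fun h => hadj x x (hr x) (Fin.ext h)
    rw [hneg x]
    split_ifs <;> first | omega | simp
  · intro x y hxy
    have h1 : (C x).val ≠ (C (neg y)).val := fun h => hadj x y hxy (Fin.ext h)
    have h2 : (C y).val ≠ (C (neg x)).val := fun h =>
      hadj y x (fun i => by rw [abs_sub_comm]; exact hxy i) (Fin.ext h)
    split_ifs <;> simp <;> omega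

lemma chrom (K : ℕ) (hm : 2 ≤ m) : (G (K+1) m hm).chromaticNumber = (K + 2 : ℕ) := by
  apply le_antisymm
  · exact (G_colorable hm).chromaticNumber_le
  · by_contra h
    push Not at h
    apply G_not_colorable K hm
    have h2 : (G (K+1) m hm).chromaticNumber ≤ ((K+1 : ℕ) : ℕ∞) := by
      apply Order.le_of_lt_add_one
      exact_mod_cast h
    exact SimpleGraph.chromaticNumber_le_iff_colorable.1 h2

lemma card_V_ge (K : ℕ) : m ≤ Fintype.card (V (K+2) m) := by
  let f : Fin m → V (K+2) m := fun a => ⟨fun i => if i = 0 then m else if i = 1 then a.val else 0, by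
    refine ⟨fun i => ?_, ⟨0, by simp⟩⟩
    have := a.2
    beta_reduce; split_ifs <;> simp <;> omega⟩
  have hf : Function.Injective f := by
    intro a b h
    have := congrFun (congrArg Subtype.val h) 1
    simp [f] at this
    exact Fin.ext this
  simpa using Fintype.card_le_of_injective f hf

end Cube

namespace Tour
open Finset

/-- The tournament on `Fin q` coded by a Boolean matrix. -/
def Q {q : ℕ} (g : Fin q → Fin q → Bool) (i j : Fin q) : Prop :=
  (xor (xor (g i j) (g j i)) (decide (i < j))) = true

lemma Q_asymm {q : ℕ} (g : Fin q → Fin q → Bool) (i j : Fin q) (h : Q g i j) : ¬ Q g j i := by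
  unfold Q at *
  rcases lt_trichotomy i j with h1 | h1 | h1
  · have : ¬ j < i := not_lt.2 h1.le
    rw [decide_eq_false this]
    rw [decide_eq_true h1] at h
    generalize g i j = a at *
    generalize g j i = b at *
    cases a <;> cases b <;> simp_all
  · subst h1
    simp at h
  · have : ¬ i < j := not_lt.2 h1.le
    rw [decide_eq_true h1]
    rw [decide_eq_false this] at h
    generalize g i j = a at *
    generalize g j i = b at *
    cases a <;> cases b <;> simp_all

instance {q : ℕ} (g : Fin q → Fin q → Bool) (i j : Fin q) : Decidable (Q g i j) := by
  unfold Q; infer_instance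

lemma pat_card {q : ℕ} (A : Finset (Fin q)) (p : Fin q → Bool) :
    (univ.filter (fun y : Fin q → Bool => ∀ a ∈ A, y a = p a)).card = 2 ^ (q - A.card) := by
  have : (univ.filter (fun y : Fin q → Bool => ∀ a ∈ A, y a = p a)) =
      Fintype.piFinset (fun a => if a ∈ A then {p a} else (univ : Finset Bool)) := by
    ext y
    simp only [mem_filter, mem_univ, true_and, Fintype.mem_piFinset]
    refine forall_congr' fun a => ?_
    by_cases h : a ∈ A <;> simp [h]
  rw [this, Fintype.card_piFinset]
  have h2 : ∀ a, (if a ∈ A then ({p a} : Finset Bool) else univ).card = if a ∈ A then 1 else 2 := by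
    intro a; split_ifs <;> simp
  simp only [h2]
  rw [Finset.prod_ite]
  simp only [prod_const_one, one_mul, prod_const]
  congr 1
  rw [Finset.filter_not, Finset.card_sdiff_of_subset (Finset.filter_subset _ _)]
  simp

lemma bad_card {q : ℕ} (A : Finset (Fin q)) :
    (univ.filter (fun g : Fin q → Fin q → Bool => ∀ j, ∃ a ∈ A, ¬ Q g j a)).card ≤
      (2 ^ q) ^ A.card * (2 ^ q - 2 ^ (q - A.card)) ^ (q - A.card) := by
  classical
  let e := Equiv.piEquivPiSubtypeProd (fun i => i ∈ A) (fun _ : Fin q => (Fin q → Bool))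
  -- for fixed rows in `A`, each further row avoids one pattern
  let pt : ({i // i ∈ A} → (Fin q → Bool)) → {i // i ∉ A} → Fin q → Bool := fun x j a =>
    if h : a ∈ A then !(xor (x ⟨a, h⟩ j.1) (decide (j.1 < a))) else true
  let B : ({i // i ∈ A} → (Fin q → Bool)) → Finset ({i // i ∉ A} → (Fin q → Bool)) := fun x =>
    Fintype.piFinset (fun j => (univ.filter (fun y : Fin q → Bool => ∀ a ∈ A, y a = pt x j a))ᶜ)
  have hB : ∀ x, (B x).card = (2 ^ q - 2 ^ (q - A.card)) ^ (q - A.card) := by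
    intro x
    simp only [B]
    rw [Fintype.card_piFinset]
    simp only [Finset.card_compl, pat_card]
    rw [Finset.prod_const]
    simp [Fintype.card_subtype_compl]
  have hle : (univ.filter (fun g : Fin q → Fin q → Bool => ∀ j, ∃ a ∈ A, ¬ Q g j a)).card ≤
      ((univ : Finset ({i // i ∈ A} → (Fin q → Bool))).sigma B).card := by
    apply Finset.card_le_card_of_injOn (fun g => ⟨(e g).1, (e g).2⟩)
    · intro g hg
      simp only [coe_filter, mem_univ, true_and, Set.mem_ofPred_eq] at hg
      simp only [coe_sigma, Set.mem_sigma_iff, mem_coe, mem_univ, true_and, B, Fintype.mem_piFinset,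
        mem_compl, mem_filter]
      intro j hall
      obtain ⟨a, ha, hQ⟩ := hg j.1
      apply hQ
      have := hall a ha
      have h1 : (e g).2 j a = g j.1 a := rfl
      have h2 : ∀ h, (e g).1 ⟨a, h⟩ j.1 = g a j.1 := fun _ => rfl
      rw [h1] at this
      simp only [pt, ha, dif_pos, h2] at this
      unfold Q
      rw [this]
      cases g a j.1 <;> cases decide (j.1 < a) <;> rfl
    · intro g _ g' _ h
      apply e.injective
      simp only [Sigma.mk.injEq, heq_eq_eq] at h
      exact Prod.ext h.1 h.2
  refine hle.trans ?_
  rw [Finset.card_sigma]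
  simp only [hB]
  simp

lemma exists_tour (q s : ℕ) (hsq : s ≤ q)
    (h : q ^ s * (2 ^ q - 2 ^ (q - s)) ^ (q - s) < (2 ^ q) ^ (q - s)) :
    ∃ Q : Fin q → Fin q → Prop, (∀ i j, Q i j → ¬ Q j i) ∧
      ∀ A : Finset (Fin q), A.card ≤ s → ∃ j, ∀ a ∈ A, Q j a := by
  classical
  have hlt : ((powersetCard s (univ : Finset (Fin q))).biUnion (fun A =>
      univ.filter (fun g : Fin q → Fin q → Bool => ∀ j, ∃ a ∈ A, ¬ Q g j a))).card <
      (univ : Finset (Fin q → Fin q → Bool)).card := by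
    have hcard : (univ : Finset (Fin q → Fin q → Bool)).card = (2^q)^q := by simp
    rw [hcard]
    calc _ ≤ ∑ A ∈ powersetCard s (univ : Finset (Fin q)), _ := Finset.card_biUnion_le
      _ ≤ ∑ A ∈ powersetCard s (univ : Finset (Fin q)),
          (2 ^ q) ^ s * (2 ^ q - 2 ^ (q - s)) ^ (q - s) := by
        apply Finset.sum_le_sum
        intro A hA
        have := bad_card A
        rwa [(mem_powersetCard.1 hA).2] at this
      _ = q.choose s * ((2 ^ q) ^ s * (2 ^ q - 2 ^ (q - s)) ^ (q - s)) := by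
        simp
      _ ≤ q ^ s * ((2 ^ q) ^ s * (2 ^ q - 2 ^ (q - s)) ^ (q - s)) :=
        Nat.mul_le_mul_right _ (Nat.choose_le_pow q s)
      _ = (2 ^ q) ^ s * (q ^ s * (2 ^ q - 2 ^ (q - s)) ^ (q - s)) := by ring
      _ < (2 ^ q) ^ s * (2 ^ q) ^ (q - s) := Nat.mul_lt_mul_of_pos_left h (by positivity)
      _ = (2 ^ q) ^ q := by rw [← pow_add]; congr 1; omega
  obtain ⟨g, -, hg⟩ := Finset.exists_mem_notMem_of_card_lt_card hlt
  refine ⟨Q g, Q_asymm g, fun A hA => ?_⟩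
  obtain ⟨A', hAA', -, hA'⟩ := Finset.exists_subsuperset_card_eq (Finset.subset_univ A) hA (by simpa using hsq)
  simp only [mem_biUnion, mem_filter, mem_univ, true_and, mem_powersetCard, not_exists, not_and,
    not_forall] at hg
  obtain ⟨j, hj⟩ := hg A' ⟨subset_univ _, hA'⟩
  refine ⟨j, fun a ha => ?_⟩
  by_contra hcon
  exact hj a (hAA' ha) hcon

lemma pow_bound (s : ℕ) (hs : 7 ≤ s) : 2 * s ^ 2 + 1 < 2 ^ s := by
  induction s, hs using Nat.le_induction with
  | base => norm_num
  | succ n hn ih => rw [pow_succ 2 n]; nlinarith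

lemma numeric (s : ℕ) (hs : 7 ≤ s) :
    (4^s) ^ s * (2 ^ (4^s) - 2 ^ (4^s - s)) ^ (4^s - s) < (2 ^ (4^s)) ^ (4^s - s) := by
  have hsq : s ≤ 2 ^ s := Nat.lt_two_pow_self.le
  have h42 : (4:ℕ)^s = 2^s * 2^s := by rw [← mul_pow]; norm_num
  have h2pos : 1 ≤ 2 ^ s := Nat.one_le_two_pow
  generalize hq : 4^s = q at *
  have hsq' : s ≤ q := by nlinarith
  have hb := pow_bound s hs
  have hle : 2 ^ (q - s) ≤ 2 ^ q := Nat.pow_le_pow_right (by norm_num) (by omega)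
  have key : ((q:ℝ)^s) * (1 - (1/2)^s)^(q - s) < 1 := by
    have h1 : (1 - (1/2:ℝ)^s) ≤ Real.exp (-(1/2)^s) := by
      have := Real.add_one_le_exp (-(1/2:ℝ)^s); linarith
    have h0 : (0:ℝ) ≤ 1 - (1/2:ℝ)^s := by
      have : (1/2:ℝ)^s ≤ 1 := pow_le_one₀ (by norm_num) (by norm_num)
      linarith
    have h2 : (1 - (1/2:ℝ)^s)^(q-s) ≤ Real.exp (-((q - s : ℕ):ℝ) * (1/2)^s) := by
      calc _ ≤ (Real.exp (-(1/2)^s))^(q-s) := pow_le_pow_left₀ h0 h1 _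
        _ = _ := by rw [← Real.exp_nat_mul]; congr 1; ring
    have h3 : (q:ℝ)^s ≤ Real.exp (2 * s^2) := by
      have : (q:ℝ) ≤ Real.exp (2 * s) := by
        rw [← hq]; push_cast
        have : (4:ℝ) ≤ Real.exp 2 := by
          have := Real.exp_one_gt_d9
          have h : Real.exp 2 = Real.exp 1 * Real.exp 1 := by rw [← Real.exp_add]; norm_num
          rw [h]; nlinarith
        calc (4:ℝ)^s ≤ (Real.exp 2)^s := pow_le_pow_left₀ (by norm_num) this _
          _ = _ := by rw [← Real.exp_nat_mul]; congr 1; ring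
      calc (q:ℝ)^s ≤ (Real.exp (2*s))^s := pow_le_pow_left₀ (by positivity) this _
        _ = _ := by rw [← Real.exp_nat_mul]; congr 1; ring
    have h4 : 2 * (s:ℝ)^2 < ((q - s : ℕ):ℝ) * (1/2)^s := by
      rw [Nat.cast_sub hsq', one_div, inv_pow, ← div_eq_mul_inv, lt_div_iff₀ (by positivity)]
      have e1 : (q:ℝ) = 2^s * 2^s := by exact_mod_cast h42
      have e2 : (s:ℝ) ≤ 2^s := by exact_mod_cast hsq
      have e3 : 2 * (s:ℝ)^2 + 1 < 2^s := by exact_mod_cast hb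
      rw [e1]
      have : (0:ℝ) < 2^s := by positivity
      nlinarith
    calc _ ≤ Real.exp (2 * s^2) * Real.exp (-((q - s : ℕ):ℝ) * (1/2)^s) :=
          mul_le_mul h3 h2 (pow_nonneg h0 _) (Real.exp_pos _).le
      _ = Real.exp (2 * s^2 + -((q - s : ℕ):ℝ) * (1/2)^s) := by rw [Real.exp_add]
      _ < 1 := by rw [Real.exp_lt_one_iff]; linarith
  have hcast : ((2 ^ q - 2 ^ (q - s) : ℕ) : ℝ) = 2 ^ q * (1 - (1/2)^s) := by
    rw [Nat.cast_sub hle]; push_cast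
    have : (2:ℝ)^q = 2^(q-s) * 2^s := by rw [← pow_add]; congr 1; omega
    rw [this, one_div, inv_pow]; field_simp
  have : ((q ^ s * (2 ^ q - 2 ^ (q - s)) ^ (q - s) : ℕ) : ℝ) < (((2 ^ q) ^ (q - s) : ℕ) : ℝ) := by
    rw [Nat.cast_mul, Nat.cast_pow (2 ^ q - 2 ^ (q - s)), hcast, mul_pow]
    push_cast
    have hp : (0:ℝ) < (2^q)^(q-s) := by positivity
    nlinarith
  exact_mod_cast this

end Tour

theorem small_case (χ : ℕ) (hχ : 1 ≤ χ) (hχ2 : χ ≤ 2) (M : ℕ) :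
    ∃ N : ℕ, M ≤ N ∧
      ∃ (G : SimpleGraph (Fin N)) (r : Fin N → Fin N → Prop),
        IsTournament r ∧
        G.CliqueFree 3 ∧
        G.chromaticNumber = χ ∧
        ∀ U : Finset (Fin N),
          (U.card : ℝ) ≤ Real.log N / (2 * (χ : ℝ) ^ 2) →
          (G.induce {u | ∃ v ∈ U, r v u}).chromaticNumber ≤ 2 := by
  let f : Fin (M + 2) → Fin χ := fun i => ⟨min i.val (χ - 1), by omega⟩
  let G : SimpleGraph (Fin (M+2)) := (⊤ : SimpleGraph (Fin χ)).comap f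
  have hcol : G.Colorable χ :=
    ⟨SimpleGraph.Coloring.mk f (fun {a b} h => h)⟩
  have hcol2 : G.Colorable 2 := hcol.mono hχ2
  refine ⟨M+2, by omega, G, fun a b => a < b, ⟨fun v => lt_irrefl v, fun u v huv => ?_⟩, ?_, ?_, ?_⟩
  · rw [not_lt]
    exact ⟨fun h => h.le, fun h => lt_of_le_of_ne h huv⟩
  · exact hcol2.cliqueFree (by norm_num)
  · apply le_antisymm hcol.chromaticNumber_le
    have hinj : ∀ a b : Fin χ, a ≠ b → G.Adj ⟨a.val, by omega⟩ ⟨b.val, by omega⟩ := by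
      intro a b hab
      change f _ ≠ f _
      intro h
      apply hab
      have := congrArg Fin.val h
      simp only [f] at this
      exact Fin.ext (by omega)
    have hhom : (⊤ : SimpleGraph (Fin χ)) →g G :=
      ⟨fun a => ⟨a.val, by omega⟩, fun {a b} h => hinj a b h⟩
    have := SimpleGraph.chromaticNumber_mono_of_hom hhom
    rwa [SimpleGraph.chromaticNumber_top, Fintype.card_fin] at this
  · intro U _
    exact SimpleGraph.Colorable.chromaticNumber_le
      (hcol2.of_hom (SimpleGraph.Embedding.induce _).toHom)

theorem big_case (K M : ℕ) :
    ∃ N : ℕ, M ≤ N ∧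
      ∃ (G : SimpleGraph (Fin N)) (r : Fin N → Fin N → Prop),
        IsTournament r ∧
        G.CliqueFree 3 ∧
        G.chromaticNumber = (K + 3 : ℕ) ∧
        ∀ U : Finset (Fin N),
          (U.card : ℝ) ≤ Real.log N / (2 * ((K + 3 : ℕ) : ℝ) ^ 2) →
          (G.induce {u | ∃ v ∈ U, r v u}).chromaticNumber ≤ 2 := by
  classical
  obtain ⟨s, hs7, hsM⟩ : ∃ s, 7 ≤ s ∧ M ≤ s := ⟨max 7 M, le_max_left _ _, le_max_right _ _⟩
  obtain ⟨q, hq⟩ : ∃ q, q = 4 ^ s := ⟨_, rfl⟩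
  have hsq : s < q := by rw [hq]; exact Nat.lt_pow_self (by norm_num)
  obtain ⟨Q, hQ, hdom⟩ := Tour.exists_tour q s hsq.le (by rw [hq]; exact Tour.numeric s hs7)
  obtain ⟨m, hm⟩ : ∃ m, q = m + 1 := ⟨q - 1, by omega⟩
  have hm2 : 2 ≤ m := by omega
  let W := Cube.V (K+2) m
  let N := Fintype.card W
  let e : W ≃ Fin N := Fintype.equivFin W
  have hlab : ∀ (x : W) i, (x.1 i).natAbs < q := by
    intro x i
    have := abs_le.1 (x.2.1 i)
    omega
  let lb : W → Fin (K+2) → Fin q := fun x i => ⟨(x.1 i).natAbs, hlab x i⟩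
  let R : W → W → Prop := fun v u => ∃ i, ∀ j, Q (lb v i) (lb u j)
  have hR : ∀ u v, R u v → ¬ R v u := by
    rintro u v ⟨i, hi⟩ ⟨j, hj⟩
    exact hQ _ _ (hi j) (hj i)
  let r : Fin N → Fin N → Prop := fun a b =>
    R (e.symm a) (e.symm b) ∨ (¬ R (e.symm b) (e.symm a) ∧ a < b)
  let G0 := Cube.G (K+2) m hm2
  let G : SimpleGraph (Fin N) := G0.comap e.symm
  let iso : G ≃g G0 := SimpleGraph.Iso.comap e.symm G0
  have hNle : N ≤ (2 * q) ^ (K+2) := by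
    refine (Cube.card_V).trans (Nat.pow_le_pow_left (by omega) _)
  have hNm : m ≤ N := Cube.card_V_ge K
  refine ⟨N, by omega, G, r, ⟨?_, ?_⟩, ?_, ?_, ?_⟩
  · rintro v (h | h)
    · exact hR _ _ h h
    · exact lt_irrefl _ h.2
  · intro u v huv
    have h1 := hR (e.symm u) (e.symm v)
    have h2 := hR (e.symm v) (e.symm u)
    simp only [r]
    by_cases a : R (e.symm u) (e.symm v)
    · simp [a, h1 a]
    · by_cases b : R (e.symm v) (e.symm u)
      · simp [a, b]
      · simp only [a, b, false_or, not_false_eq_true, true_and, not_lt]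
        exact ⟨fun h => h.le, fun h => lt_of_le_of_ne h huv⟩
  · exact (Cube.G_cliqueFree hm2).comap ⟨iso.toEmbedding.toCopy⟩
  · rw [← Cube.chrom (K+1) hm2]
    exact le_antisymm (SimpleGraph.chromaticNumber_mono_of_hom iso.toHom)
      (SimpleGraph.chromaticNumber_mono_of_hom iso.symm.toHom)
  · intro U hU
    -- size bound
    have hUs : U.card * (K+2) + 1 ≤ s := by
      have hN0 : (0:ℝ) < N := by
        have : 0 < N := by omega
        exact_mod_cast this
      have hlog : Real.log N < (K+2) * (2 * s) := by
        have h1 : Real.log N ≤ (K+2) * Real.log (2 * q) := by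
          have : (N:ℝ) ≤ (2 * q) ^ (K+2) := by exact_mod_cast hNle
          calc Real.log N ≤ Real.log ((2 * q) ^ (K+2)) := Real.log_le_log hN0 this
            _ = _ := by rw [Real.log_pow]; push_cast; ring
        have hq0 : (0:ℝ) < 2 * q := by
          have : 0 < q := by omega
          positivity
        have h2 : Real.log (2 * q) < 2 * s := by
          rw [Real.log_lt_iff_lt_exp hq0]
          have e7 : (7:ℝ) ≤ Real.exp 2 := by
            have := Real.exp_one_gt_d9
            have h : Real.exp 2 = Real.exp 1 * Real.exp 1 := by rw [← Real.exp_add]; norm_num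
            rw [h]; nlinarith
          have e8 : ∀ n : ℕ, 7 ≤ n → 2 * 4 ^ n < 7 ^ n := by
            intro n hn
            induction n, hn using Nat.le_induction with
            | base => norm_num
            | succ n hn ih => rw [pow_succ 4 n, pow_succ 7 n]; omega
          calc (2:ℝ) * q < 7 ^ s := by rw [hq]; exact_mod_cast e8 s hs7
            _ ≤ (Real.exp 2) ^ s := pow_le_pow_left₀ (by norm_num) e7 _
            _ = _ := by rw [← Real.exp_nat_mul]; congr 1; ring
        have : (0:ℝ) < K + 2 := by positivity
        nlinarith
      have hk : (0:ℝ) < 2 * ((K + 3 : ℕ) : ℝ) ^ 2 := by positivity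
      rw [le_div_iff₀ hk] at hU
      push_cast at hU
      have h3 : (U.card : ℝ) * (K + 2) < s := by
        by_contra hcon
        push Not at hcon
        have hK0 : (0:ℝ) ≤ K := by positivity
        have hU0 : (0:ℝ) ≤ U.card := by positivity
        have h4 : (U.card:ℝ) * (K+3)^2 < (K+2) * s := by nlinarith
        have h5 : ((K:ℝ)+2) * s ≤ (K+2) * (U.card * (K+2)) :=
          mul_le_mul_of_nonneg_left hcon (by positivity)
        nlinarith
      have h4 : U.card * (K+2) < s := by exact_mod_cast h3
      omega
    let mm : Fin q := ⟨m, by omega⟩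
    let A : Finset (Fin q) := insert mm
      ((U ×ˢ (Finset.univ : Finset (Fin (K+2)))).image (fun p => lb (e.symm p.1) p.2))
    have hA : A.card ≤ s := by
      refine (Finset.card_insert_le _ _).trans ?_
      refine le_trans (Nat.add_le_add_right Finset.card_image_le 1) ?_
      rw [Finset.card_product, Finset.card_univ, Fintype.card_fin]
      exact hUs
    obtain ⟨c, hc⟩ := hdom A hA
    have hcm : c.val < m := by
      have h1 := hc mm (Finset.mem_insert_self _ _)
      have h2 : c ≠ mm := by
        intro h
        rw [h] at h1
        exact hQ _ _ h1 h1
      have h3 : c.val ≠ m := fun h => h2 (Fin.ext h)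
      have := c.2
      omega
    let S : Set W := {x | ∀ i, |x.1 i| ≠ (c.val : ℤ)}
    have h2c := Cube.two_col hm2 c.val hcm S (fun x hx => hx)
    have hsub : ∀ u ∈ {u | ∃ v ∈ U, r v u}, e.symm u ∈ S := by
      rintro u ⟨v, hv, hvu⟩ i hi
      have hl : lb (e.symm u) i = c := by
        apply Fin.ext
        simp only [lb]
        rw [Int.abs_eq_natAbs] at hi
        exact_mod_cast hi
      have hRuv : R (e.symm u) (e.symm v) := by
        refine ⟨i, fun j => ?_⟩
        rw [hl]
        apply hc
        apply Finset.mem_insert_of_mem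
        exact Finset.mem_image.2 ⟨(v, j), by simp [hv], rfl⟩
      rcases hvu with h | h
      · exact hR _ _ hRuv h
      · exact h.1 hRuv
    let hom : G.induce {u | ∃ v ∈ U, r v u} →g G0.induce S :=
      ⟨fun u => ⟨e.symm u.1, hsub u.1 u.2⟩, fun {a b} h => h⟩
    exact (h2c.of_hom hom).chromaticNumber_le

/-- For every positive integer χ there are arbitrarily large N with a
triangle-free graph G and a tournament T on the same N-element vertex set such that
χ(G) = χ and every set U of at most (log N)/(2χ²) vertices has
χ(G[N⁺_T(U)]) ≤ 2. -/
theorem stmt_0 (χ : ℕ) (hχ : 1 ≤ χ) (M : ℕ) :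
    ∃ N : ℕ, M ≤ N ∧
      ∃ (G : SimpleGraph (Fin N)) (r : Fin N → Fin N → Prop),
        IsTournament r ∧
        G.CliqueFree 3 ∧
        G.chromaticNumber = χ ∧
        ∀ U : Finset (Fin N),
          (U.card : ℝ) ≤ Real.log N / (2 * (χ : ℝ) ^ 2) →
          (G.induce {u | ∃ v ∈ U, r v u}).chromaticNumber ≤ 2 := by
  by_cases h : χ ≤ 2
  · exact small_case χ hχ h M
  · obtain ⟨K, rfl⟩ : ∃ K, χ = K + 3 := ⟨χ - 3, by omega⟩
    exact big_case K M
end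

section
/- For every positive integer χ there are arbitrarily large N for which there exist tournaments T₁ and T₂ on the same N-element vertex set such that χ(T₁) = χ and, for every set U of at most (log N)/(8χ²) vertices, the subtournament of T₁ induced on the out-neighbourhood N⁺_{T₂}(U) has chromatic number at most 2. -/
/-- The relation `r` is transitive on the set `W`; for a tournament this says that
the subtournament induced on `W` is transitive (acyclic). -/
def TransOn {V : Type*} (r : V → V → Prop) (W : Set V) : Prop :=
  ∀ u ∈ W, ∀ v ∈ W, ∀ w ∈ W, r u v → r v w → r u w

/-- The chromatic number of the subtournament of `r` induced on `W`: the least `m`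
such that `W` can be partitioned into `m` parts, each inducing a transitive
subtournament. -/
noncomputable def tournChromOn {V : Type*} (r : V → V → Prop) (W : Set V) : ℕ :=
  sInf {m : ℕ | ∃ c : V → Fin m, ∀ i : Fin m, TransOn r {v ∈ W | c v = i}}


lemma dom_arith (R : ℕ) :
    (16^R)^R * (2^R-1)^(16^R-R) < (2^R)^(16^R-R) := by
  have hn : 1 ≤ 2^R := Nat.one_le_two_pow
  have hR : R < 2^R := Nat.lt_two_pow_self
  have hbern : ∀ n : ℕ, 1 ≤ n → (n-1)^n * 2 ≤ n^n := by
    intro n hn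
    obtain ⟨k, rfl⟩ : ∃ k, n = k+1 := ⟨n-1, by omega⟩
    simp only [Nat.add_sub_cancel]
    have : (k+1)^(k+1) = k^(k+1) + (k+1)*k^k + ((k+1)^(k+1) - k^(k+1) - (k+1)*k^k) := by
      have : k^(k+1) + (k+1)*k^k ≤ (k+1)^(k+1) := by
        have := add_pow (k:ℕ) 1 (k+1)
        rw [this, Finset.sum_range_succ, Finset.sum_range_succ]
        simp
        have : (k+1)*k^k = k^k*(k+1) := by ring
        omega
      omega
    have h2 : k^(k+1) ≤ (k+1)*k^k := by
      rw [pow_succ]; nlinarith [Nat.zero_le (k^k)]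
    omega
  set n := 2^R with hnd
  have h16 : 16^R = n^4 := by rw [hnd, ← pow_mul, mul_comm, pow_mul]; norm_num
  have hj : n*(4*R^2+1) ≤ 16^R - R := by
    have key : n*(4*R^2+1) + R ≤ n^4 := by
      have hR' : R + 1 ≤ n := hR
      obtain ⟨t, ht⟩ : ∃ t, n = R + 1 + t := ⟨n - (R+1), by omega⟩
      have hR2 : 2*R ≤ n := by
        rw [hnd]; 
        rcases R with _ | r
        · simp
        · have : r < 2^r := Nat.lt_two_pow_self
          rw [pow_succ]; omega
      have h1 : 4*R^2 ≤ n^2 := by nlinarith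
      have h3 : n * (4*R^2+1) ≤ n*(n^2+1) := Nat.mul_le_mul_left _ (by omega)
      rcases Nat.lt_or_ge n 2 with h | h
      · have : n = 1 := by omega
        have : R = 0 := by omega
        subst this; simp [‹n = 1›]
      · have : n*(n^2+1) + n ≤ n^4 := by nlinarith [pow_pos (by omega : 0 < n) 3, mul_self_nonneg (n-2:ℤ), pow_two n, pow_succ n 3, pow_succ n 2]
        omega
    rw [h16]; omega
  set K := 16^R - R
  obtain ⟨ρ, hρ⟩ : ∃ ρ, K = n*(4*R^2+1) + ρ := ⟨K - n*(4*R^2+1), by omega⟩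
  have h1 : (16^R)^R * 2 = 2^(4*R^2+1) := by
    rw [← pow_mul, pow_succ, show (16:ℕ) = 2^4 by norm_num, ← pow_mul]; congr 2; ring
  have h2 : 2^(4*R^2+1) * (n-1)^K ≤ n^K := by
    rw [hρ]
    generalize 4*R^2+1 = j
    rw [pow_add, pow_add, pow_mul, pow_mul, ← mul_assoc, ← mul_pow]
    apply Nat.mul_le_mul
    · apply Nat.pow_le_pow_left; rw [mul_comm]; exact hbern n hn
    · apply Nat.pow_le_pow_left; omega
  have h3 : 0 < n^K := by positivity
  rw [← h1] at h2
  nlinarith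

open Finset in
lemma dom_exists (R : ℕ) : ∃ D : Fin (16^R) → Fin (16^R) → Prop,
    (∀ a b, D a b → ¬ D b a) ∧
    ∀ S : Finset (Fin (16^R)), S.card ≤ R → ∃ a, ∀ b ∈ S, D a b := by
  classical
  have harith := dom_arith R
  have hmR : R ≤ 16^R := (Nat.lt_pow_self (by norm_num)).le
  generalize hm : 16^R = m at *
  let Dg : (Fin m → Fin m → Bool) → Fin m → Fin m → Bool :=
    fun g a b => (g a b ^^ g b a) ^^ decide (a < b)
  -- bad functions
  let T : Finset (Fin m) → Finset (Fin m → Fin m → Bool) := fun S =>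
    Fintype.piFinset (fun a => if a ∈ S then univ else univ.filter (fun row => ∃ b ∈ S, row b = false))
  let Bad : Finset (Fin m) → Finset (Fin m → Fin m → Bool) := fun S =>
    univ.filter (fun g => ∀ a, a ∉ S → ∃ b ∈ S, Dg g a b = false)
  let Φ : Finset (Fin m) → (Fin m → Fin m → Bool) → (Fin m → Fin m → Bool) :=
    fun S g a b => if a ∉ S ∧ b ∈ S then Dg g a b else g a b
  have hΦ : ∀ S, Function.Injective (Φ S) := by
    intro S g g' h
    have hb : ∀ b ∈ S, ∀ a, g b a = g' b a := by
      intro b hb a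
      have := congrFun (congrFun h b) a
      simpa [Φ, hb] using this
    funext a b
    have := congrFun (congrFun h a) b
    by_cases h1 : a ∉ S ∧ b ∈ S
    · simp only [Φ, h1, not_false_eq_true, and_self, if_true, Dg, hb b h1.2 a] at this
      simpa using this
    · simpa only [Φ, h1, if_false] using this
  have hcardBad : ∀ S, (Bad S).card ≤ (T S).card := by
    intro S
    refine card_le_card_of_injOn (Φ S) ?_ (hΦ S).injOn
    intro g hg
    have hg : ∀ a, a ∉ S → ∃ b ∈ S, Dg g a b = false := by simpa [Bad] using hg
    simp only [T, mem_coe, Fintype.mem_piFinset]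
    intro a
    by_cases ha : a ∈ S
    · simp [ha]
    · obtain ⟨b, hb, hd⟩ := hg a ha
      simp only [ha, if_false, mem_filter, mem_univ, true_and]
      exact ⟨b, hb, by simp [Φ, ha, hb, hd]⟩
  have hrow : ∀ S : Finset (Fin m), S.card = R →
      (univ.filter (fun row : Fin m → Bool => ∃ b ∈ S, row b = false)).card = 2^(m-R) * (2^R-1) := by
    intro S hS
    have h1 : (univ.filter (fun row : Fin m → Bool => ¬ ∃ b ∈ S, row b = false)).card = 2^(m-R) := by
      have : univ.filter (fun row : Fin m → Bool => ¬ ∃ b ∈ S, row b = false) =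
          Fintype.piFinset (fun b => if b ∈ S then {true} else univ) := by
        ext row
        simp only [mem_filter, mem_univ, true_and, Fintype.mem_piFinset]
        constructor
        · intro h b
          by_cases hb : b ∈ S
          · simp only [hb, if_true, mem_singleton]
            by_contra hc; exact h ⟨b, hb, by simpa using hc⟩
          · simp [hb]
        · rintro h ⟨b, hb, hf⟩
          have := h b
          simp [hb, hf] at this
      rw [this, Fintype.card_piFinset]
      rw [show (fun b => (if b ∈ S then ({true} : Finset Bool) else univ).card) = fun b => if b ∈ S then 1 else 2 by
        funext b; split_ifs <;> simp]
      rw [prod_ite]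
      simp only [prod_const, one_pow, one_mul]
      congr 1
      rw [filter_not, filter_mem_eq_inter, univ_inter, card_sdiff_of_subset (subset_univ _)]; simp [hS]
    have h2 := card_filter_add_card_filter_not (s := (univ : Finset (Fin m → Bool))) (fun row => ∃ b ∈ S, row b = false)
    rw [h1] at h2
    simp at h2
    have h3 : 2^m = 2^(m-R) * 2^R := by rw [← pow_add]; congr 1; omega
    rw [h3] at h2
    rw [Nat.mul_sub, mul_one]; omega
  have hT : ∀ S : Finset (Fin m), S.card = R →
      (T S).card = (2^m)^R * (2^(m-R) * (2^R-1))^(m-R) := by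
    intro S hS
    simp only [T]
    rw [Fintype.card_piFinset]
    rw [show (fun a => (if a ∈ S then (univ : Finset (Fin m → Bool)) else univ.filter (fun row => ∃ b ∈ S, row b = false)).card)
        = fun a => if a ∈ S then 2^m else 2^(m-R) * (2^R-1) by
        funext b; split_ifs
        · simp
        · exact hrow S hS]
    rw [prod_ite]
    simp only [prod_const]
    congr 2
    · simp [hS]
    · rw [filter_not, filter_mem_eq_inter, univ_inter, card_sdiff_of_subset (subset_univ _)]; simp [hS]
  have hex : ∃ g : Fin m → Fin m → Bool, ∀ S ∈ powersetCard R (univ : Finset (Fin m)), g ∉ Bad S := by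
    by_contra hc
    push Not at hc
    have hsub : (univ : Finset (Fin m → Fin m → Bool)) ⊆ (powersetCard R univ).biUnion Bad := by
      intro g _
      obtain ⟨S, hS, hg⟩ := hc g
      exact mem_biUnion.2 ⟨S, hS, hg⟩
    have h1 := (card_le_card hsub).trans (card_biUnion_le_card_mul _ _ ((2^m)^R * (2^(m-R) * (2^R-1))^(m-R)) (by
      intro S hS
      rw [← hT S (mem_powersetCard.1 hS).2]; exact hcardBad S))
    rw [card_powersetCard] at h1
    simp only [card_univ, Fintype.card_pi, Fintype.card_bool, prod_const, Fintype.card_fin] at h1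
    have h2 : m.choose R ≤ m^R := Nat.choose_le_pow _ _
    have h3 : ((2^m)^m : ℕ) = (2^m)^R * ((2^(m-R))^(m-R) * (2^R)^(m-R)) := by
      rw [← mul_pow, ← pow_add, Nat.sub_add_cancel hmR, ← pow_add]; congr 1; omega
    rw [h3] at h1
    have h4 : m.choose R * ((2^m)^R * (2^(m-R) * (2^R-1))^(m-R)) ≤
       (2^m)^R * ((2^(m-R))^(m-R) * (m^R * (2^R-1)^(m-R))) := by
      rw [mul_pow]
      calc _ ≤ m^R * ((2^m)^R * ((2^(m-R))^(m-R) * (2^R-1)^(m-R))) := Nat.mul_le_mul_right _ h2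
        _ = _ := by ring
    have h5 : (2^m)^R * ((2^(m-R))^(m-R) * (m^R * (2^R-1)^(m-R))) < (2^m)^R * ((2^(m-R))^(m-R) * (2^R)^(m-R)) := by
      gcongr
    omega
  obtain ⟨g, hg⟩ := hex
  refine ⟨fun a b => a ≠ b ∧ Dg g a b = true, ?_, ?_⟩
  · rintro a b ⟨hab, h1⟩ ⟨_, h2⟩
    simp only [Dg] at h1 h2
    rcases lt_or_gt_of_ne hab with h | h
    · have h' : ¬ b < a := not_lt.2 h.le
      simp only [h, h', decide_true, decide_false] at h1 h2
      revert h1 h2; cases g a b <;> cases g b a <;> simp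
    · have h' : ¬ a < b := not_lt.2 h.le
      simp only [h, h', decide_true, decide_false] at h1 h2
      revert h1 h2; cases g a b <;> cases g b a <;> simp
  · intro S hS
    obtain ⟨S', hSS, hS'⟩ := exists_superset_card_eq hS (by simpa using hmR)
    have := hg S' (mem_powersetCard.2 ⟨subset_univ _, hS'⟩)
    simp only [Bad, mem_filter, mem_univ, true_and, not_forall] at this
    obtain ⟨a, ha, h⟩ := this
    push Not at h
    exact ⟨a, fun b hb => ⟨fun hab => ha (hab ▸ hSS hb), by simpa using h b (hSS hb)⟩⟩

section chains
variable {P : Type*}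

abbrev Ch (P : Type*) := List P →₀ ZMod 2

noncomputable def chCons (x : P) : Ch P →ₗ[ZMod 2] Ch P := Finsupp.lmapDomain _ _ (List.cons x)
noncomputable def chMap (f : P → P) : Ch P →ₗ[ZMod 2] Ch P := Finsupp.lmapDomain _ _ (List.map f)

noncomputable def bdL : List P → Ch P
  | [] => 0
  | x :: l => Finsupp.single l 1 + chCons x (bdL l)

noncomputable def bd : Ch P →ₗ[ZMod 2] Ch P := Finsupp.linearCombination _ bdL

noncomputable def prL (e f : P → P) : List P → Ch P
  | [] => 0
  | x :: l => Finsupp.single (e x :: f x :: l.map f) 1 + chCons (e x) (prL e f l)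

noncomputable def pr (e f : P → P) : Ch P →ₗ[ZMod 2] Ch P := Finsupp.linearCombination _ (prL e f)

@[simp] lemma chCons_single (x : P) (l : List P) (a : ZMod 2) :
    chCons x (Finsupp.single l a) = Finsupp.single (x :: l) a := by simp [chCons]
@[simp] lemma chMap_single (f : P → P) (l : List P) (a : ZMod 2) :
    chMap f (Finsupp.single l a) = Finsupp.single (l.map f) a := by simp [chMap]
@[simp] lemma bd_single (l : List P) : bd (Finsupp.single l 1) = bdL l := by simp [bd]
@[simp] lemma pr_single (e f : P → P) (l : List P) : pr e f (Finsupp.single l 1) = prL e f l := by simp [pr]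

lemma ch_ext {M : Type*} [AddCommMonoid M] [Module (ZMod 2) M] {φ ψ : Ch P →ₗ[ZMod 2] M}
    (h : ∀ l, φ (Finsupp.single l 1) = ψ (Finsupp.single l 1)) : φ = ψ := by
  apply Finsupp.lhom_ext'
  intro l
  apply LinearMap.ext_ring
  simpa using h l

lemma ch_self (c : Ch P) : c + c = 0 := by
  rw [← two_smul (ZMod 2) c, show (2 : ZMod 2) = 0 from rfl, zero_smul]

lemma bd_cons (x : P) (c : Ch P) : bd (chCons x c) = c + chCons x (bd c) := by
  have : bd ∘ₗ chCons x = LinearMap.id + chCons x ∘ₗ bd := by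
    apply ch_ext; intro l; simp [bdL]
  simpa using LinearMap.congr_fun this c

lemma chMap_cons (f : P → P) (x : P) (c : Ch P) : chMap f (chCons x c) = chCons (f x) (chMap f c) := by
  have : chMap f ∘ₗ chCons x = chCons (f x) ∘ₗ chMap f := by
    apply ch_ext; intro l; simp
  simpa using LinearMap.congr_fun this c

lemma pr_cons (e f : P → P) (x : P) (c : Ch P) :
    pr e f (chCons x c) = chCons (e x) (chCons (f x) (chMap f c)) + chCons (e x) (pr e f c) := by
  have : pr e f ∘ₗ chCons x = chCons (e x) ∘ₗ chCons (f x) ∘ₗ chMap f + chCons (e x) ∘ₗ pr e f := by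
    apply ch_ext; intro l; simp [prL]
  simpa using LinearMap.congr_fun this c

lemma bd_map (f : P → P) (c : Ch P) : bd (chMap f c) = chMap f (bd c) := by
  have : bd ∘ₗ chMap f = chMap f ∘ₗ bd := by
    apply ch_ext; intro l
    induction l with
    | nil => simp [bdL]
    | cons x l ih => 
      simp only [LinearMap.comp_apply, chMap_single, bd_single, List.map_cons] at ih ⊢
      simp [bdL, ih, chMap_cons]
  simpa using LinearMap.congr_fun this c

lemma pr_homotopy (e f : P → P) (c : Ch P) :
    bd (pr e f c) + pr e f (bd c) = chMap f c + chMap e c := by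
  have : bd ∘ₗ pr e f + pr e f ∘ₗ bd = chMap f + chMap e := by
    apply ch_ext; intro l
    induction l with
    | nil => simp [bdL, prL, ch_self]
    | cons x l ih =>
      simp only [LinearMap.add_apply, LinearMap.comp_apply, chMap_single, bd_single, pr_single] at ih ⊢
      simp only [prL, bdL, map_add, bd_single, pr_single, bd_cons, pr_cons, List.map_cons, chCons_single]
      have hm : bdL (l.map f) = chMap f (bdL l) := by
        have := bd_map f (Finsupp.single l 1); simpa using this
      rw [hm]
      have ih' := congrArg (chCons (e x)) ih
      simp only [map_add, chCons_single] at ih'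
      generalize Finsupp.single (f x :: l.map f) (1 : ZMod 2) = A at *
      generalize (Finsupp.single (e x :: List.map f l) (1 : ZMod 2)) = B at *
      generalize (Finsupp.single (e x :: List.map e l) (1 : ZMod 2)) = C at *
      generalize chCons (e x) (chCons (f x) (chMap f (bdL l))) = E at *
      generalize prL e f l = G at *
      generalize chCons (e x) (bd G) = H at *
      generalize chCons (e x) (pr e f (bdL l)) = I at *
      calc _ = A + (E + E) + (G + G) + (H + I) + B := by abel
        _ = A + C + (B + B) := by rw [ih', ch_self, ch_self]; abel
        _ = _ := by rw [ch_self]; abel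
  simpa using LinearMap.congr_fun this c

/-- support predicate -/
def Supp (p : List P → Prop) : Submodule (ZMod 2) (Ch P) := Finsupp.supported _ _ {l | p l}

lemma supp_map {p q : List P → Prop} (L : Ch P →ₗ[ZMod 2] Ch P)
    (h : ∀ l, p l → L (Finsupp.single l 1) ∈ Supp q) {c : Ch P} (hc : c ∈ Supp p) : L c ∈ Supp q := by
  unfold Supp at hc
  rw [Finsupp.supported_eq_span_single] at hc
  refine (Submodule.span_le (p := (Supp q).comap L)).2 ?_ hc
  rintro _ ⟨l, hl, rfl⟩
  exact h l hl

lemma supp_single {p : List P → Prop} {l : List P} (h : p l) : Finsupp.single l 1 ∈ Supp p :=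
  Finsupp.single_mem_supported _ _ h

lemma supp_eq {p : List P → Prop} (φ ψ : Ch P →ₗ[ZMod 2] ZMod 2)
    (h : ∀ l, p l → φ (Finsupp.single l 1) = ψ (Finsupp.single l 1)) {c : Ch P} (hc : c ∈ Supp p) :
    φ c = ψ c := by
  unfold Supp at hc
  rw [Finsupp.supported_eq_span_single] at hc
  refine (Submodule.span_le (p := LinearMap.eqLocus φ ψ)).2 ?_ hc
  rintro _ ⟨l, hl, rfl⟩
  exact h l hl

/-- the cochains -/
def wL (g : P → ZMod 2) : List P → ZMod 2
  | [] => 0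
  | [_] => 1
  | x :: y :: l => (g x + g y) * wL g (y :: l)

def uL (g : P → ZMod 2) : List P → ZMod 2
  | [] => 0
  | x :: l => g x * wL g (x :: l)

noncomputable def wC (g : P → ZMod 2) : Ch P →ₗ[ZMod 2] ZMod 2 := Finsupp.linearCombination _ (wL g)
noncomputable def uC (g : P → ZMod 2) : Ch P →ₗ[ZMod 2] ZMod 2 := Finsupp.linearCombination _ (uL g)
@[simp] lemma wC_single (g : P → ZMod 2) (l : List P) : wC g (Finsupp.single l 1) = wL g l := by simp [wC]
@[simp] lemma uC_single (g : P → ZMod 2) (l : List P) : uC g (Finsupp.single l 1) = uL g l := by simp [uC]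

lemma z2_self (a : ZMod 2) : a + a = 0 := CharTwo.add_self_eq_zero a

lemma wC_cons_cons (g : P → ZMod 2) (x y : P) (c : Ch P) :
    wC g (chCons x (chCons y c)) = (g x + g y) * wC g (chCons y c) := by
  have : wC g ∘ₗ chCons x ∘ₗ chCons y = (g x + g y) • (wC g ∘ₗ chCons y) := by
    apply ch_ext; intro l; simp [wL]
  simpa using LinearMap.congr_fun this c

lemma uC_cons (g : P → ZMod 2) (x : P) (c : Ch P) :
    uC g (chCons x c) = g x * wC g (chCons x c) := by
  have : uC g ∘ₗ chCons x = g x • (wC g ∘ₗ chCons x) := by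
    apply ch_ext; intro l; simp [uL]
  simpa using LinearMap.congr_fun this c

/-- cocycle identity -/
lemma w_cocycle (g : P → ZMod 2) (l : List P) : ∀ (x y : P),
    wC g (chCons x (bdL (y :: l))) = wL g (y :: l) := by
  induction l with
  | nil => intro x y; simp [bdL, wL]
  | cons z l ih =>
    intro x y
    have h := ih y z
    rw [bdL, map_add, map_add, chCons_single, wC_single, wC_cons_cons, h]
    simp only [wL]
    linear_combination (wL g (z :: l)) * z2_self (g x)

lemma u_bd (g : P → ZMod 2) (x y : P) (l : List P) :
    uC g (bdL (x :: y :: l)) = wL g (x :: y :: l) := by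
  rw [bdL, map_add, uC_cons, w_cocycle, uC_single, uL, wL]; ring

end chains

section sphere
variable {m : ℕ}

/-- sign vectors -/
abbrev SV (m : ℕ) := Fin m → SignType

def fM (p : ℕ) (X : SV m) : SV m := fun a => if a.1 < p then X a else 1
def eM (p : ℕ) (X : SV m) : SV m := fun a => if a.1 < p then X a else if a.1 = p then 0 else 1

/-- `Y` refines `X` -/
def Rf (X Y : SV m) : Prop := ∀ a, X a ≠ 0 → Y a = X a

lemma Rf.refl (X : SV m) : Rf X X := fun _ _ => rfl
lemma Rf.trans {X Y Z : SV m} (h : Rf X Y) (h' : Rf Y Z) : Rf X Z := by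
  intro a ha
  have h1 := h a ha
  rw [h' a (by rwa [h1]), h1]
lemma Rf.neg {X Y : SV m} (h : Rf X Y) : Rf (-X) (-Y) := by
  intro a ha
  have : X a ≠ 0 := by
    intro h0; apply ha; simp [h0]
  simp [h a this]
lemma rf_f {X Y : SV m} (h : Rf X Y) (p : ℕ) : Rf (fM p X) (fM p Y) := by
  intro a ha
  simp only [fM] at *
  split_ifs with h1
  · rw [if_pos h1] at ha; exact h a ha
  · rfl
lemma rf_e {X Y : SV m} (h : Rf X Y) (p : ℕ) : Rf (eM p X) (eM p Y) := by
  intro a ha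
  simp only [eM] at *
  split_ifs with h1
  · rw [if_pos h1] at ha; exact h a ha
  · rfl
  · rfl
lemma rf_ef (X : SV m) (p : ℕ) : Rf (eM p X) (fM p X) := by
  intro a ha
  simp only [eM, fM] at *
  split_ifs at * <;> simp_all
lemma rf_ef' (X : SV m) (p : ℕ) : Rf (eM p X) (fM (p+1) X) := by
  intro a ha
  simp only [eM, fM] at *
  split_ifs at * <;> first | rfl | omega | simp_all

lemma fM_top (X : SV m) : fM m X = X := by
  funext a; simp [fM]
lemma fM_zero (X : SV m) : fM 0 X = 1 := by
  funext a; simp [fM]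

/-- the filling operator -/
noncomputable def fillN (m n : ℕ) : Ch (SV m) →ₗ[ZMod 2] Ch (SV m) :=
  ∑ p ∈ Finset.range n, (pr (eM p) (fM (p+1)) + pr (eM p) (fM p))

/-- the full filling operator -/
noncomputable def fill (m : ℕ) : Ch (SV m) →ₗ[ZMod 2] Ch (SV m) :=
  ∑ p ∈ Finset.range m, (pr (eM p) (fM (p+1)) + pr (eM p) (fM p))

lemma fill_homotopy (c : Ch (SV m)) :
    bd (fill m c) + fill m (bd c) = c + chMap (fun _ => 1) c := by
  have key : ∀ n : ℕ, bd (fillN m n c) + fillN m n (bd c) = chMap (fM n) c + chMap (fM 0) c := by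
    intro n
    induction n with
    | zero => simp [fillN, ch_self]
    | succ n ih =>
      have hs : fillN m (n+1) = fillN m n + (pr (eM n) (fM (n+1)) + pr (eM n) (fM n)) :=
        Finset.sum_range_succ _ _
      rw [hs]
      simp only [LinearMap.add_apply, map_add]
      have h1 := pr_homotopy (eM n) (fM (n+1)) c
      have h2 := pr_homotopy (eM n) (fM n) c
      generalize bd (pr (eM n) (fM (n+1)) c) = A at *
      generalize pr (eM n) (fM (n+1)) (bd c) = A' at *
      generalize bd (pr (eM n) (fM (n)) c) = B at *
      generalize pr (eM n) (fM (n)) (bd c) = B' at *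
      calc _ = (bd (fillN m n c) + fillN m n (bd c)) + (A + A') + (B + B') := by abel
        _ = chMap (fM (n+1)) c + chMap (fM 0) c + (chMap (fM n) c + chMap (fM n) c) + (chMap (eM n) c + chMap (eM n) c) := by
          rw [ih, h1, h2]; abel
        _ = _ := by rw [ch_self, ch_self]; abel
  have h := key m
  have h1 : chMap (fM (m := m) m) = LinearMap.id := by
    apply ch_ext; intro l
    have : fM (m := m) m = id := funext fM_top
    simp [this]
  have h2 : fM (m := m) 0 = fun _ => 1 := funext fM_zero
  rw [h1, h2] at h
  exact h

noncomputable def hC (m : ℕ) : ℕ → Ch (SV m)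
  | 0 => Finsupp.single [1] 1
  | k+1 => fill m (hC m k + chMap Neg.neg (hC m k))

lemma chMap_comp {P : Type*} (f g : P → P) (c : Ch P) : chMap f (chMap g c) = chMap (f ∘ g) c := by
  have : chMap f ∘ₗ chMap g = chMap (f ∘ g) := by
    apply ch_ext; intro l; simp
  simpa using LinearMap.congr_fun this c

lemma chMap_id {P : Type*} (f : P → P) (hf : ∀ x, f x = x) (c : Ch P) : chMap f c = c := by
  have : chMap f = LinearMap.id := by
    apply ch_ext; intro l
    have : f = id := funext hf
    simp [this]
  simpa using LinearMap.congr_fun this c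

lemma hC_sym (c : Ch (SV m)) : chMap Neg.neg (c + chMap Neg.neg c) = c + chMap Neg.neg c := by
  rw [map_add, chMap_comp, chMap_id (_ ∘ _) (fun x => by simp), add_comm]

lemma bd_hC : ∀ k, bd (hC m k + chMap Neg.neg (hC m k)) = 0 ∧
    bd (hC m (k+1)) = hC m k + chMap Neg.neg (hC m k) := by
  have step : ∀ k, bd (hC m k + chMap Neg.neg (hC m k)) = 0 →
      bd (hC m (k+1)) = hC m k + chMap Neg.neg (hC m k) := by
    intro k h
    have h1 := fill_homotopy (hC m k + chMap Neg.neg (hC m k))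
    rw [h, map_zero, add_zero] at h1
    rw [hC, h1, map_add (chMap _), chMap_comp]
    have : (fun _ : SV m => (1 : SV m)) ∘ Neg.neg = fun _ => 1 := rfl
    rw [this, ch_self, add_zero]
  intro k
  induction k with
  | zero =>
    have : bd (hC m 0 + chMap Neg.neg (hC m 0)) = 0 := by
      simp [hC, bdL, ch_self]
    exact ⟨this, step 0 this⟩
  | succ k ih =>
    have : bd (hC m (k+1) + chMap Neg.neg (hC m (k+1))) = 0 := by
      rw [map_add, bd_map, ih.2, hC_sym, ch_self]
    exact ⟨this, step _ this⟩

/-- the vertex sets -/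
def QS (m : ℕ) : ℕ → Finset (SV m)
  | 0 => {1, -1}
  | k+1 => (QS m k ×ˢ Finset.range (m+1) ×ˢ (Finset.univ : Finset (Bool × Bool))).image
      (fun t => (if t.2.2.1 then (fun x => x) else Neg.neg)
        ((if t.2.2.2 then fM t.2.1 else eM t.2.1) t.1))

lemma QS_neg : ∀ {k : ℕ} {X : SV m}, X ∈ QS m k → -X ∈ QS m k := by
  intro k X h
  cases k with
  | zero => 
    simp only [QS, Finset.mem_insert, Finset.mem_singleton] at h ⊢
    rcases h with rfl | rfl <;> simp
  | succ k =>
    simp only [QS, Finset.mem_image] at h ⊢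
    obtain ⟨⟨Y, p, b, b'⟩, h, rfl⟩ := h
    refine ⟨⟨Y, p, !b, b'⟩, ?_, ?_⟩
    · simpa using h
    · cases b <;> simp

lemma QS_f {k p : ℕ} {X : SV m} (h : X ∈ QS m k) (hp : p ≤ m) : fM p X ∈ QS m (k+1) := by
  simp only [QS, Finset.mem_image]
  exact ⟨⟨X, p, true, true⟩, by simp [h]; omega, by simp⟩
lemma QS_e {k p : ℕ} {X : SV m} (h : X ∈ QS m k) (hp : p ≤ m) : eM p X ∈ QS m (k+1) := by
  simp only [QS, Finset.mem_image]
  exact ⟨⟨X, p, true, false⟩, by simp [h]; omega, by simp⟩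
lemma QS_mono {k l : ℕ} (h : k ≤ l) : QS m k ⊆ QS m l := by
  induction l, h using Nat.le_induction with
  | base => exact subset_rfl
  | succ l _ ih =>
    intro X hX
    have := QS_f (ih hX) le_rfl
    rwa [fM_top] at this

lemma QS_card (k : ℕ) : (QS m k).card ≤ 2 * (4*(m+1))^k := by
  induction k with
  | zero => exact Finset.card_le_two
  | succ k ih =>
    refine Finset.card_image_le.trans ?_
    simp only [Finset.card_product, Finset.card_range, Finset.card_univ, Fintype.card_prod, Fintype.card_bool]
    rw [pow_succ]
    nlinarith

def zeros (X : SV m) : Finset (Fin m) := Finset.univ.filter (fun a => X a = 0)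

lemma mem_zeros (X : SV m) (a : Fin m) : a ∈ zeros X ↔ X a = 0 := by simp [zeros]

lemma QS_zeros : ∀ {k : ℕ} {X : SV m}, X ∈ QS m k → (zeros X).card ≤ k := by
  intro k
  induction k with
  | zero =>
    intro X h
    simp only [QS, Finset.mem_insert, Finset.mem_singleton] at h
    rcases h with rfl | rfl <;> simp [zeros] 
  | succ k ih =>
    intro X h
    simp only [QS, Finset.mem_image] at h
    obtain ⟨⟨Y, p, b, b'⟩, h, rfl⟩ := h
    simp only [Finset.mem_product] at h
    have hY := ih h.1
    have hneg : ∀ Z : SV m, zeros (-Z) = zeros Z := by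
      intro Z; ext a; simp [zeros]
    have hf : (zeros (fM p Y)).card ≤ k + 1 := by
      refine (Finset.card_le_card ?_).trans (hY.trans (Nat.le_succ k))
      intro a
      simp only [mem_zeros, fM]
      split_ifs <;> simp
    have he : (zeros (eM p Y)).card ≤ k + 1 := by
      by_cases hp : p < m
      · have : zeros (eM p Y) ⊆ insert ⟨p, hp⟩ (zeros Y) := by
          intro a
          simp only [mem_zeros, eM, Finset.mem_insert, Fin.ext_iff]
          split_ifs with h1 h2 <;> simp_all
        exact (Finset.card_le_card this).trans ((Finset.card_insert_le _ _).trans (by omega))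
      · refine (Finset.card_le_card ?_).trans (hY.trans (Nat.le_succ k))
        intro a
        have := a.2
        simp only [mem_zeros, eM]
        split_ifs <;> first | omega | simp
    cases b <;> cases b' <;> simp only [if_true, Bool.false_eq_true, if_false, hneg] <;> assumption

/-- good flags -/
def Good (k : ℕ) (l : List (SV m)) : Prop :=
  l.length = k + 1 ∧ l.Pairwise Rf ∧ ∀ X ∈ l, X ∈ QS m k

lemma pr_supp (e f : SV m → SV m) (he : ∀ X Y, Rf X Y → Rf (e X) (e Y)) (hf : ∀ X Y, Rf X Y → Rf (f X) (f Y))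
    (hef : ∀ X, Rf (e X) (f X)) (A B : Finset (SV m)) (hA : ∀ X ∈ A, e X ∈ B ∧ f X ∈ B)
    (l : List (SV m)) (hl : l.Pairwise Rf) (hlA : ∀ X ∈ l, X ∈ A) :
    prL e f l ∈ Supp (fun l' => l'.length = l.length + 1 ∧ l'.Pairwise Rf ∧ (∀ X ∈ l', X ∈ B) ∧
      ∀ Y ∈ l', ∃ X ∈ l, Rf (e X) Y) := by
  induction l with
  | nil => exact Submodule.zero_mem _
  | cons x l ih =>
    rw [List.pairwise_cons] at hl
    have hx := hA x (hlA x (by simp))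
    have hlA' : ∀ X ∈ l, X ∈ A := fun X hX => hlA X (by simp [hX])
    rw [prL]
    refine Submodule.add_mem _ (supp_single ?_) ?_
    · refine ⟨by simp, ?_, ?_, ?_⟩
      · rw [List.pairwise_cons, List.pairwise_cons]
        refine ⟨?_, ?_, ?_⟩
        · intro Y hY
          rcases List.mem_cons.1 hY with rfl | hY
          · exact hef x
          · obtain ⟨Z, hZ, rfl⟩ := List.mem_map.1 hY
            exact (hef x).trans (hf _ _ (hl.1 Z hZ))
        · intro Y hY
          obtain ⟨Z, hZ, rfl⟩ := List.mem_map.1 hY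
          exact hf _ _ (hl.1 Z hZ)
        · exact List.Pairwise.map _ (fun a b h => hf a b h) hl.2
      · intro Y hY
        rcases List.mem_cons.1 hY with rfl | hY
        · exact hx.1
        rcases List.mem_cons.1 hY with rfl | hY
        · exact hx.2
        obtain ⟨Z, hZ, rfl⟩ := List.mem_map.1 hY
        exact (hA Z (hlA' Z hZ)).2
      · intro Y hY
        rcases List.mem_cons.1 hY with rfl | hY
        · exact ⟨x, by simp, Rf.refl _⟩
        rcases List.mem_cons.1 hY with rfl | hY
        · exact ⟨x, by simp, hef x⟩
        obtain ⟨Z, hZ, rfl⟩ := List.mem_map.1 hY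
        exact ⟨Z, by simp [hZ], hef Z⟩
    · refine supp_map (chCons (e x)) ?_ (ih hl.2 hlA')
      rintro l' ⟨h1, h2, h3, h4⟩
      rw [chCons_single]
      refine supp_single ⟨by simp [h1], ?_, ?_, ?_⟩
      · rw [List.pairwise_cons]
        refine ⟨?_, h2⟩
        intro Y hY
        obtain ⟨Z, hZ, h⟩ := h4 Y hY
        exact (he _ _ (hl.1 Z hZ)).trans h
      · intro Y hY
        rcases List.mem_cons.1 hY with rfl | hY
        · exact hx.1
        · exact h3 Y hY
      · intro Y hY
        rcases List.mem_cons.1 hY with rfl | hY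
        · exact ⟨x, by simp, Rf.refl _⟩
        · obtain ⟨Z, hZ, h⟩ := h4 Y hY
          exact ⟨Z, by simp [hZ], h⟩

lemma supp_mono {P : Type*} {p q : List P → Prop} (h : ∀ l, p l → q l) {c : Ch P} (hc : c ∈ Supp p) : c ∈ Supp q :=
  Finsupp.supported_mono (fun l hl => h l hl) hc

lemma hC_supp (k : ℕ) : hC m k ∈ Supp (Good k) := by
  induction k with
  | zero => exact supp_single ⟨by simp, by simp, by simp [QS]⟩
  | succ k ih =>
    rw [hC]
    have h1 : hC m k + chMap Neg.neg (hC m k) ∈ Supp (Good (m := m) k) := by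
      refine Submodule.add_mem _ ih (supp_map _ ?_ ih)
      rintro l ⟨h1, h2, h3⟩
      rw [chMap_single]
      refine supp_single ⟨by simp [h1], List.Pairwise.map _ (fun a b h => Rf.neg h) h2, ?_⟩
      intro Y hY
      obtain ⟨Z, hZ, rfl⟩ := List.mem_map.1 hY
      exact QS_neg (h3 Z hZ)
    refine supp_map _ ?_ h1
    rintro l ⟨h1, h2, h3⟩
    unfold fill
    rw [LinearMap.sum_apply]
    refine Submodule.sum_mem _ ?_
    intro p hp
    have hp := Finset.mem_range.1 hp
    rw [LinearMap.add_apply, pr_single, pr_single]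
    refine Submodule.add_mem _ ?_ ?_
    · refine supp_mono ?_ (pr_supp (eM p) (fM (p+1)) (fun _ _ h => rf_e h p) (fun _ _ h => rf_f h _)
        (fun X => rf_ef' X p) (QS m k) (QS m (k+1)) (fun X hX => ⟨QS_e hX hp.le, QS_f hX hp⟩) l h2 h3)
      rintro l' ⟨a, b, c, _⟩
      exact ⟨by omega, b, c⟩
    · refine supp_mono ?_ (pr_supp (eM p) (fM p) (fun _ _ h => rf_e h p) (fun _ _ h => rf_f h _)
        (fun X => rf_ef X p) (QS m k) (QS m (k+1)) (fun X hX => ⟨QS_e hX hp.le, QS_f hX hp.le⟩) l h2 h3)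
      rintro l' ⟨a, b, c, _⟩
      exact ⟨by omega, b, c⟩

lemma wL_neg (g : SV m → ZMod 2) : ∀ l : List (SV m), (∀ X ∈ l, g (-X) = g X + 1) →
    wL g (l.map Neg.neg) = wL g l
  | [], _ => rfl
  | [_], _ => rfl
  | x :: y :: l, h => by
    have ih := wL_neg g (y :: l) (fun X hX => h X (by simp [hX]))
    simp only [List.map_cons] at ih ⊢
    rw [wL, wL, ih, h x (by simp), h y (by simp)]
    linear_combination (wL g (y :: l)) * z2_self 1

/-- evaluation of the top class -/
lemma w_hC (g : SV m → ZMod 2) (d : ℕ) (hg : ∀ X ∈ QS m d, g (-X) = g X + 1) :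
    ∀ k ≤ d, wC g (hC m k) = 1 := by
  intro k
  induction k with
  | zero => intro _; simp [hC, wL]
  | succ k ih =>
    intro hk
    rw [← ih (by omega)]
    have h1 : wC g (hC m (k+1)) = (uC g ∘ₗ bd) (hC m (k+1)) := by
      refine supp_eq (p := Good (k+1)) _ _ ?_ (hC_supp _)
      rintro l ⟨h1, _, _⟩
      match l, h1 with
      | x :: y :: l, _ => simp [u_bd]
    rw [h1, LinearMap.comp_apply, (bd_hC k).2]
    have h2 : (uC g ∘ₗ (LinearMap.id + chMap Neg.neg)) (hC m k) = wC g (hC m k) := by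
      refine supp_eq (p := Good k) _ _ ?_ (hC_supp _)
      rintro l ⟨h1, _, h3⟩
      have h3' : ∀ X ∈ l, g (-X) = g X + 1 := fun X hX => hg X (QS_mono (by omega) (h3 X hX))
      match l, h1 with
      | x :: l, _ =>
        have := wL_neg g (x :: l) h3'
        simp only [List.map_cons] at this
        simp only [LinearMap.comp_apply, LinearMap.add_apply, LinearMap.id_apply, chMap_single, map_add, uC_single, wC_single,
          List.map_cons, uL, this, h3' x (by simp)]
        linear_combination (wL g (x :: l)) * z2_self (g x)
    simpa using h2

lemma exists_flag (g : SV m → ZMod 2) (d : ℕ) (hg : ∀ X ∈ QS m d, g (-X) = g X + 1) :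
    ∃ l : List (SV m), Good d l ∧ wL g l ≠ 0 := by
  by_contra hc
  push Not at hc
  have h1 := w_hC g d hg d le_rfl
  have : wC g (hC m d) = (0 : Ch (SV m) →ₗ[ZMod 2] ZMod 2) (hC m d) := by
    refine supp_eq (p := Good d) _ _ ?_ (hC_supp _)
    intro l hl; simp [hc l hl]
  rw [h1] at this
  simp at this

/-- a flag with alternating signs forces many values -/
lemma flag_values (g : SV m → ZMod 2) (M : SV m → ℕ) (d : ℕ)
    (hM : ∀ X ∈ QS m d, ∀ Y ∈ QS m d, Rf X Y → M X ≤ M Y ∧ (M X = M Y → g X = g Y)) :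
    ∀ (l : List (SV m)) (x : SV m), (x :: l).Pairwise Rf → (∀ X ∈ x :: l, X ∈ QS m d) → wL g (x :: l) ≠ 0 →
      ∃ Y ∈ x :: l, M x + l.length ≤ M Y := by
  intro l
  induction l with
  | nil => intro x _ _ _; exact ⟨x, by simp, by simp⟩
  | cons y l ih =>
    intro x h1 h2 h3
    rw [List.pairwise_cons] at h1
    rw [wL] at h3
    obtain ⟨Y, hY, hle⟩ := ih y h1.2 (fun X hX => h2 X (by simp [List.mem_cons.1 hX])) (right_ne_zero_of_mul h3)
    have h4 := hM x (h2 x (by simp)) y (h2 y (by simp)) (h1.1 y (by simp))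
    have h5 : M x ≠ M y := by
      intro h
      apply left_ne_zero_of_mul h3
      rw [h4.2 h]; exact z2_self _
    refine ⟨Y, by simp [List.mem_cons.1 hY], ?_⟩
    have := lt_of_le_of_ne h4.1 h5
    simp; omega

/-- adjacency graph on sign vectors -/
def Opp (X Y : SV m) : Prop := ∀ a, X a = Y a → X a = 0

/-- chromatic lower bound -/
lemma color_bound (d C : ℕ) (hd : d < m) (c : SV m → ℕ) (hC : ∀ X ∈ QS m d, c X < C)
    (hc : ∀ X ∈ QS m d, ∀ Y ∈ QS m d, X ≠ Y → Opp X Y → c X ≠ c Y) : d < C := by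
  classical
  let S : SV m → Finset ℕ := fun X => ((QS m d).filter (fun Y => Rf Y X)).image c
  let M : SV m → ℕ := fun X => (S X ∪ S (-X)).sup id
  let g : SV m → ZMod 2 := fun X => if M X ∈ S X then 1 else 0
  have hSmono : ∀ X Y, Rf X Y → S X ⊆ S Y := by
    intro X Y h i hi
    simp only [S, Finset.mem_image, Finset.mem_filter] at hi ⊢
    obtain ⟨Z, ⟨h1, h2⟩, h3⟩ := hi
    exact ⟨Z, ⟨h1, h2.trans h⟩, h3⟩
  have hmem : ∀ X ∈ QS m d, c X ∈ S X := by
    intro X hX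
    exact Finset.mem_image.2 ⟨X, Finset.mem_filter.2 ⟨hX, Rf.refl X⟩, rfl⟩
  have hdisj : ∀ X i, i ∈ S X → i ∉ S (-X) := by
    intro X i hi hi'
    simp only [S, Finset.mem_image, Finset.mem_filter] at hi hi'
    obtain ⟨Y, ⟨h1, h2⟩, h3⟩ := hi
    obtain ⟨Z, ⟨h1', h2'⟩, h3'⟩ := hi'
    have hopp : Opp Y Z := by
      intro a ha
      by_contra h0
      have e1 := h2 a h0
      have e2 := h2' a (ha ▸ h0)
      rw [Pi.neg_apply, e1, ← ha] at e2
      revert h0 e2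
      cases Y a <;> decide
    have hne : Y ≠ Z := by
      rintro rfl
      have := QS_zeros h1
      have hz : zeros Y = Finset.univ := by
        ext a; simp [zeros, hopp a rfl]
      rw [hz] at this
      simp at this; omega
    exact hc Y h1 Z h1' hne hopp (h3.trans h3'.symm)
  have hMneg : ∀ X, M (-X) = M X := by
    intro X; simp only [M, neg_neg]; rw [Finset.union_comm]
  have hMmem : ∀ X ∈ QS m d, M X ∈ S X ∪ S (-X) := by
    intro X hX
    have hne : (S X ∪ S (-X)).Nonempty := ⟨c X, Finset.mem_union_left _ (hmem X hX)⟩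
    obtain ⟨i, hi, h⟩ := Finset.exists_mem_eq_sup _ hne id
    have : M X = i := h
    rw [this]; exact hi
  have hg : ∀ X ∈ QS m d, g (-X) = g X + 1 := by
    intro X hX
    simp only [g, hMneg]
    rcases Finset.mem_union.1 (hMmem X hX) with h | h
    · rw [if_neg (hdisj X _ h), if_pos h]; rfl
    · have : M X ∉ S X := fun h' => hdisj X _ h' h
      rw [if_pos h, if_neg this]; rfl
  have hMg : ∀ X ∈ QS m d, ∀ Y ∈ QS m d, Rf X Y → M X ≤ M Y ∧ (M X = M Y → g X = g Y) := by
    intro X hX Y hY h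
    refine ⟨Finset.sup_mono (Finset.union_subset_union (hSmono _ _ h) (hSmono _ _ h.neg)), ?_⟩
    intro he
    simp only [g, ← he]
    rcases Finset.mem_union.1 (hMmem X hX) with h1 | h1
    · rw [if_pos h1, if_pos (hSmono _ _ h h1)]
    · have h2 := hSmono _ _ h.neg h1
      rw [if_neg (fun h' => hdisj X _ h' h1), if_neg (fun h' => hdisj Y _ h' h2)]
  obtain ⟨l, ⟨h1, h2, h3⟩, h4⟩ := exists_flag g d hg
  match l, h1 with
  | x :: l, h1 =>
    obtain ⟨Y, hY, hle⟩ := flag_values g M d hMg l x h2 h3 h4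
    have hMC : M Y < C := by
      have := hMmem Y (h3 Y hY)
      simp only [S, Finset.mem_union, Finset.mem_image, Finset.mem_filter] at this
      rcases this with ⟨Z, hZ, h⟩ | ⟨Z, hZ, h⟩
      · rw [← h]; exact hC Z hZ.1
      · rw [← h]; exact hC Z hZ.1
    simp at h1
    omega

end sphere

/-- colourability of the subtournament on `W` with `n` colours -/
def Col {V : Type*} (r : V → V → Prop) (W : Set V) (n : ℕ) : Prop :=
  ∃ c : V → ℕ, (∀ v ∈ W, c v < n) ∧ ∀ i, TransOn r {v | v ∈ W ∧ c v = i}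

lemma Col.mono {V : Type*} {r : V → V → Prop} {W : Set V} {n n' : ℕ} (h : Col r W n) (hn : n ≤ n') :
    Col r W n' := by
  obtain ⟨c, h1, h2⟩ := h
  exact ⟨c, fun v hv => (h1 v hv).trans_le hn, h2⟩

lemma Col.insert {V : Type*} {r : V → V → Prop} (hr : ∀ v, ¬ r v v) {W : Set V} {n : ℕ} (h : Col r W n) (v : V) :
    Col r (insert v W) (n+1) := by
  classical
  obtain ⟨c, h1, h2⟩ := h
  refine ⟨fun u => if u ∈ W then c u else n, ?_, ?_⟩
  · intro u hu
    dsimp only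
    split_ifs with h
    · have := h1 u h; omega
    · omega
  · intro i x hx y hy z hz hxy hyz
    simp only [Set.mem_ofPred_eq, Set.mem_insert_iff] at hx hy hz
    by_cases hi : i = n
    · subst hi
      have key : ∀ u, ((u = v ∨ u ∈ W) ∧ (if u ∈ W then c u else i) = i) → u = v := by
        rintro u ⟨h, h'⟩
        by_cases hu : u ∈ W
        · rw [if_pos hu] at h'; have := h1 u hu; omega
        · tauto
      rw [key x hx, key y hy] at hxy
      exact absurd hxy (hr v)
    · have key : ∀ u, ((u = v ∨ u ∈ W) ∧ (if u ∈ W then c u else n) = i) → u ∈ W ∧ c u = i := by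
        rintro u ⟨h, h'⟩
        by_cases hu : u ∈ W
        · rw [if_pos hu] at h'; exact ⟨hu, h'⟩
        · rw [if_neg hu] at h'; exact absurd h'.symm hi
      exact h2 i x (key x hx) y (key y hy) z (key z hz) hxy hyz

lemma exists_source {V : Type*} [DecidableEq V] {r : V → V → Prop} (hr : IsTournament r) (Z : Finset V) (hZ : Z.Nonempty)
    (ht : TransOn r (Z : Set V)) : ∃ z ∈ Z, ∀ y ∈ Z, y ≠ z → r z y := by
  induction hZ using Finset.Nonempty.cons_induction with
  | singleton a => exact ⟨a, by simp, by simp⟩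
  | cons a Z ha hZ ih =>
    obtain ⟨z, hz, h⟩ := ih (fun u hu v hv w hw => ht u (by simp at hu ⊢; tauto) v (by simp at hv ⊢; tauto) w (by simp at hw ⊢; tauto))
    have haz : a ≠ z := fun e => ha (e ▸ hz)
    by_cases h1 : r z a
    · refine ⟨z, by simp [hz], ?_⟩
      intro y hy hyz
      rcases Finset.mem_cons.1 hy with rfl | hy
      · exact h1
      · exact h y hy hyz
    · have h2 : r a z := (hr.2 a z haz).2 h1
      refine ⟨a, by simp, ?_⟩
      intro y hy hya
      rcases Finset.mem_cons.1 hy with rfl | hy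
      · exact absurd rfl hya
      · by_cases hyz : y = z
        · rw [hyz]; exact h2
        · exact ht a (by simp) z (by simp [hz]) y (by simp [hy]) h2 (h y hy hyz)

section T1
variable {m s : ℕ}

open Classical in
/-- the first tournament -/
def R1 (o : SV m → ℕ) (D : Fin s → Fin s → Prop) (u v : SV m × Fin s) : Prop :=
  if u.1 = v.1 then u.2 < v.2
  else if Opp u.1 v.1 then (if o u.1 < o v.1 then D u.2 v.2 else ¬ D v.2 u.2)
  else o u.1 < o v.1

lemma Opp.symm {X Y : SV m} (h : Opp X Y) : Opp Y X := fun a ha => by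
  rw [ha]; exact h a ha.symm

lemma R1_tour (o : SV m → ℕ) (ho : Function.Injective o) (D : Fin s → Fin s → Prop) :
    IsTournament (R1 o D) := by
  constructor
  · intro v; simp [R1]
  · rintro ⟨X, x⟩ ⟨Y, y⟩ hne
    by_cases h : X = Y
    · subst h
      have : x ≠ y := fun h => hne (by rw [h])
      simp only [R1, if_true]
      rw [not_lt]; exact ⟨le_of_lt, fun h => lt_of_le_of_ne h this⟩
    · have h' : Y ≠ X := fun e => h e.symm
      have hoo : o X ≠ o Y := fun e => h (ho e)
      by_cases hO : Opp X Y
      · have hO' := hO.symm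
        simp only [R1, h, h', hO, hO', if_true, if_false]
        rcases lt_or_gt_of_ne hoo with hlt | hlt
        · simp [hlt, hlt.not_gt]
        · simp [hlt, hlt.not_gt]
      · have hO' : ¬ Opp Y X := fun e => hO e.symm
        simp only [R1, h, h', hO, hO', if_false]
        omega

/-- sign classes are transitive -/
lemma R1_trans (o : SV m → ℕ) (D : Fin s → Fin s → Prop) (W : Set (SV m × Fin s))
    (hW : ∀ u ∈ W, ∀ v ∈ W, ¬ Opp u.1 v.1) : TransOn (R1 o D) W := by
  rintro ⟨X, x⟩ hX ⟨Y, y⟩ hY ⟨Z, z⟩ hZ hxy hyz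
  have h1 := hW _ hX _ hY
  have h2 := hW _ hY _ hZ
  have h3 := hW _ hX _ hZ
  simp only [R1, h1, h2, h3, if_false] at *
  by_cases e1 : X = Y
  · subst e1
    by_cases e2 : X = Z
    · subst e2; simp at *; exact hxy.trans hyz
    · simp_all
  · by_cases e2 : Y = Z
    · subst e2; simp_all
    · simp only [e1, e2, if_false] at *
      have : X ≠ Z := by rintro rfl; omega
      simp only [this, if_false]; omega

lemma R1_lower (o : SV m → ℕ) (ho : Function.Injective o) (D : Fin s → Fin s → Prop)
    (hD : ∀ a b, D a b → ¬ D b a) (d n : ℕ) (hd : d < m)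
    (hdom : ∀ S : Finset (Fin s), S.card ≤ n → ∃ a, ∀ b ∈ S, D a b)
    (hcol : Col (R1 o D) {v | v.1 ∈ QS m d} n) : d < n := by
  classical
  obtain ⟨c, h1, h2⟩ := hcol
  have hbig : ∀ X : SV m, ∃ i, X ∈ QS m d → i < n ∧ ∀ z, ∃ x, c (X, x) = i ∧ D x z := by
    intro X
    by_contra hc
    push Not at hc
    have hX := (hc 0).1
    have hc' : ∀ i, ∃ z, i < n → ∀ x, c (X, x) = i → ¬ D x z := by
      intro i
      by_cases hi : i < n
      · obtain ⟨z, hz⟩ := (hc i).2 hi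
        exact ⟨z, fun _ => hz⟩
      · obtain ⟨a, _⟩ := hdom ∅ (by simp)
        exact ⟨a, fun h => absurd h hi⟩
    choose z hz using hc'
    obtain ⟨a, ha⟩ := hdom ((Finset.range n).image z) (Finset.card_image_le.trans (by simp))
    have hlt := h1 (X, a) hX
    exact hz _ hlt a rfl (ha _ (Finset.mem_image_of_mem z (Finset.mem_range.2 hlt)))
  choose C hC using hbig
  refine color_bound d n hd C (fun X hX => (hC X hX).1) ?_
  have main : ∀ X ∈ QS m d, ∀ Y ∈ QS m d, o X < o Y → Opp X Y → C X ≠ C Y := by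
    intro X hX Y hY hlt hO he
    have hXY : X ≠ Y := by rintro rfl; omega
    have hYX : Y ≠ X := hXY.symm
    let Z : Finset (SV m × Fin s) := Finset.univ.filter (fun v => (v.1 = X ∨ v.1 = Y) ∧ c v = C X)
    have hZ : Z.Nonempty := by
      obtain ⟨a, _⟩ := hdom ∅ (by simp)
      obtain ⟨x, hx, _⟩ := (hC X hX).2 a
      exact ⟨(X, x), by simp [Z, hx]⟩
    have hZt : TransOn (R1 o D) (Z : Set _) := by
      have key : ∀ u ∈ (Z : Set (SV m × Fin s)), u ∈ {v | v ∈ {v : SV m × Fin s | v.1 ∈ QS m d} ∧ c v = C X} := by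
        intro u hu
        simp only [Z, Finset.coe_filter, Finset.mem_univ, true_and, Set.mem_ofPred_eq] at hu ⊢
        refine ⟨?_, hu.2⟩
        rcases hu.1 with h | h <;> rw [h] <;> assumption
      intro u hu v hv w hw
      exact h2 (C X) u (key u hu) v (key v hv) w (key w hw)
    obtain ⟨⟨A, x⟩, hz, hs⟩ := exists_source (R1_tour o ho D) Z hZ hZt
    simp only [Z, Finset.mem_filter, Finset.mem_univ, true_and] at hz hs
    rcases hz.1 with rfl | rfl
    · obtain ⟨y, hy, hyx⟩ := (hC Y hY).2 x
      have := hs (Y, y) ⟨Or.inr rfl, hy.trans he.symm⟩ (by simp [hYX])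
      simp only [R1, hXY, hO, hlt, if_true, if_false] at this
      exact hD _ _ this hyx
    · obtain ⟨y, hy, hyx⟩ := (hC X hX).2 x
      have := hs (X, y) ⟨Or.inl rfl, hy⟩ (by simp [hXY])
      simp only [R1, hYX, hO.symm, hlt.not_gt, if_true, if_false] at this
      exact this hyx
  intro X hX Y hY hne hO
  rcases lt_or_gt_of_ne (fun e => hne (ho e)) with h | h
  · exact main X hX Y hY h hO
  · exact (main Y hY X hX h hO.symm).symm

end T1

lemma final_arith (χ s R N : ℕ) (hχ : 1 ≤ χ) (hR : R = 2 * s) (hs : 1 ≤ s) (hN0 : 1 ≤ N)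
    (hN : N ≤ 2 * (4*(16^R+1))^χ * s) (k : ℕ) (hk : (k : ℝ) ≤ Real.log N / (8 * (χ : ℝ)^2)) :
    k * χ ≤ R := by
  have hχ' : (1:ℝ) ≤ χ := by exact_mod_cast hχ
  have h1 : (N : ℝ) ≤ (2 * s) * (8 * 16^R)^χ := by
    have : N ≤ (2 * s) * (8 * 16^R)^χ := by
      refine hN.trans ?_
      have : 1 ≤ 16^R := Nat.one_le_pow _ _ (by norm_num)
      have : (4*(16^R+1))^χ ≤ (8 * 16^R)^χ := Nat.pow_le_pow_left (by omega) _
      nlinarith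
    exact_mod_cast this
  have hs' : (1:ℝ) ≤ s := by exact_mod_cast hs
  have h2 : Real.log N ≤ Real.log (2*s) + χ * (Real.log 8 + R * Real.log 16) := by
    refine (Real.log_le_log (by exact_mod_cast hN0) h1).trans ?_
    rw [Real.log_mul (by positivity) (by positivity), Real.log_pow,
      Real.log_mul (x := 8) (by norm_num) (by positivity), Real.log_pow]
  have h3 : Real.log (2*s) ≤ 2*s - 1 := Real.log_le_sub_one_of_pos (by positivity)
  have hl2 := Real.log_two_lt_d9
  have h8 : Real.log 8 = 3 * Real.log 2 := by
    rw [show (8:ℝ) = 2^3 by norm_num, Real.log_pow]; norm_num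
  have h16 : Real.log 16 = 4 * Real.log 2 := by
    rw [show (16:ℝ) = 2^4 by norm_num, Real.log_pow]; norm_num
  have hRr : (R : ℝ) = 2 * s := by rw [hR]; push_cast; ring
  rw [le_div_iff₀ (by positivity)] at hk
  have h4 : (k:ℝ) * χ * (8 * χ) ≤ 8 * R * χ := by
    have e1 : (k:ℝ) * χ * (8 * χ) = k * (8 * (χ:ℝ)^2) := by ring
    rw [e1]
    refine hk.trans (h2.trans ?_)
    rw [h8, h16]
    have e2 : Real.log (2*s) ≤ χ * (R:ℝ) := by
      rw [hRr]; nlinarith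
    have e3 : 3 * Real.log 2 + R * (4 * Real.log 2) ≤ 7 * (R:ℝ) := by
      rw [hRr]; nlinarith
    nlinarith
  have h5 : (k:ℝ) * χ ≤ R := by
    by_contra hc
    push Not at hc
    nlinarith
  exact_mod_cast h5

set_option maxHeartbeats 1000000 in
theorem stmt_1 (χ : ℕ) (hχ : 1 ≤ χ) (M : ℕ) :
    ∃ N : ℕ, M ≤ N ∧
      ∃ r₁ r₂ : Fin N → Fin N → Prop,
        IsTournament r₁ ∧ IsTournament r₂ ∧
        tournChromOn r₁ Set.univ = χ ∧
        ∀ U : Finset (Fin N),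
          (U.card : ℝ) ≤ Real.log N / (8 * (χ : ℝ) ^ 2) →
          tournChromOn r₁ {u | ∃ v ∈ U, r₂ v u} ≤ 2 := by
  classical
  have hD0 := dom_exists (max χ M)
  obtain ⟨s, hs⟩ : ∃ s, s = 16^(max χ M) := ⟨_, rfl⟩
  rw [← hs] at hD0
  obtain ⟨D', hD', hdom'⟩ := hD0
  have hs1 : max χ M < s := by
    rw [hs]; exact Nat.lt_pow_self (by norm_num)
  have hχs : χ < s := (le_max_left _ _).trans_lt hs1
  have hMs : M < s := (le_max_right _ _).trans_lt hs1
  obtain ⟨R, hR⟩ : ∃ R, R = 2 * s := ⟨_, rfl⟩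
  obtain ⟨D, hD, hdom⟩ := dom_exists R
  have hRm : R < 16^R := Nat.lt_pow_self (by norm_num)
  have hmdef : ∃ m, m = 16^R := ⟨_, rfl⟩
  obtain ⟨m, hm⟩ := hmdef
  rw [← hm] at hRm
  have hdm : χ < m := by omega
  revert D
  rw [← hm]
  intro D hD hdom
  obtain ⟨o, ho⟩ : ∃ o : SV m → ℕ, Function.Injective o :=
    ⟨fun X => (Fintype.equivFin (SV m) X : ℕ), fun X Y h => (Fintype.equivFin (SV m)).injective (Fin.ext h)⟩
  let r := R1 o D'
  have hrt : IsTournament r := R1_tour o ho D'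
  -- the vertex set
  let VV : Finset (SV m × Fin s) := QS m χ ×ˢ Finset.univ
  let W0 : Finset (SV m × Fin s) := {1} ×ˢ Finset.univ
  have hone : (1 : SV m) ∈ QS m χ := QS_mono (Nat.zero_le χ) (by simp [QS])
  have hW0V : W0 ⊆ VV := by
    intro v hv
    simp only [W0, VV, Finset.mem_product, Finset.mem_singleton, Finset.mem_univ, and_true] at hv ⊢
    rw [hv]; exact hone
  have hnoppone : ∀ X : SV m, (∃ a, X a ≠ 0) → ¬ Opp X X := by
    rintro X ⟨a, ha⟩ h; exact ha (h a rfl)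
  have hW0c : Col r (W0 : Set _) χ := by
    refine Col.mono (n := 1) ⟨fun _ => 0, fun _ _ => by norm_num, ?_⟩ hχ
    intro i
    apply R1_trans
    rintro u ⟨hu, _⟩ v ⟨hv, _⟩
    simp only [W0, Finset.mem_coe, Finset.mem_product, Finset.mem_singleton, Finset.mem_univ, and_true] at hu hv
    rw [hu, hv]
    exact hnoppone _ ⟨⟨0, by omega⟩, by simp⟩
  have hVnc : ¬ Col r (VV : Set _) χ := by
    intro h
    have hset : (VV : Set (SV m × Fin s)) = {v | v.1 ∈ QS m χ} := by
      ext v; simp [VV]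
    rw [hset] at h
    have := R1_lower o ho D' hD' χ χ hdm (fun S hS => hdom' S (hS.trans (le_max_left _ _))) h
    omega
  -- maximal `χ`-colourable set
  obtain ⟨W, hWm, hWmax⟩ := Finset.exists_max_image
    (VV.powerset.filter (fun W => W0 ⊆ W ∧ Col r (W : Set _) χ)) Finset.card
    ⟨W0, by simp only [Finset.mem_filter, Finset.mem_powerset]; exact ⟨hW0V, subset_rfl, hW0c⟩⟩
  simp only [Finset.mem_filter, Finset.mem_powerset] at hWm hWmax
  obtain ⟨hWV, hW0W, hWc⟩ := hWm
  have hWne : W ≠ VV := by rintro rfl; exact hVnc hWc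
  obtain ⟨v0, hv0, hv0W⟩ := Finset.exists_of_ssubset (Finset.ssubset_iff_subset_ne.2 ⟨hWV, hWne⟩)
  have hWnc : ∀ n, Col r (W : Set _) n → χ ≤ n := by
    intro n hn
    by_contra hlt
    have h1 := (hn.insert hrt.1 v0).mono (show n + 1 ≤ χ by omega)
    have h2 := hWmax (insert v0 W) ⟨Finset.insert_subset hv0 hWV, hW0W.trans (Finset.subset_insert _ _), by
      simpa using h1⟩
    rw [Finset.card_insert_of_notMem hv0W] at h2
    omega
  have hWs : s ≤ W.card := by
    have := Finset.card_le_card hW0W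
    simpa [W0] using this
  have hWcard : W.card ≤ 2 * (4*(16^R+1))^χ * s := by
    refine (Finset.card_le_card hWV).trans ?_
    simp only [VV, Finset.card_product, Finset.card_univ, Fintype.card_fin]
    rw [← hm]
    exact Nat.mul_le_mul_right _ (QS_card χ)
  let e : Fin W.card → SV m × Fin s := fun i => (W.equivFin.symm i : SV m × Fin s)
  have he : Function.Injective e := fun i j h => W.equivFin.symm.injective (Subtype.ext h)
  have heW : ∀ i, e i ∈ W := fun i => (W.equivFin.symm i).2
  have hesurj : ∀ w ∈ W, ∃ i, e i = w := fun w hw => ⟨W.equivFin ⟨w, hw⟩, by simp [e]⟩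
  let dm : Fin W.card → Fin W.card → Prop := fun u v =>
    ∃ a ∈ zeros (e u).1, ∀ b ∈ zeros (e v).1, D a b
  have hdm2 : ∀ u v, dm u v → ¬ dm v u := by
    rintro u v ⟨a, ha, h⟩ ⟨b, hb, h'⟩
    exact hD a b (h b hb) (h' a ha)
  refine ⟨W.card, by omega, fun u v => r (e u) (e v), fun u v => dm u v ∨ (¬ dm v u ∧ u < v), ?_, ?_, ?_, ?_⟩
  · exact ⟨fun v => hrt.1 _, fun u v huv => hrt.2 _ _ (fun h => huv (he h))⟩
  · constructor
    · intro v h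
      rcases h with h | h
      · exact hdm2 v v h h
      · exact lt_irrefl _ h.2
    · intro u v huv
      have h1 := hdm2 u v
      show (dm u v ∨ (¬ dm v u ∧ u < v)) ↔ ¬ (dm v u ∨ (¬ dm u v ∧ v < u))
      generalize dm u v = P at *
      generalize dm v u = Q at *
      clear * - h1 huv
      rcases lt_or_gt_of_ne huv with h | h
      · have : ¬ v < u := h.not_gt
        tauto
      · have : ¬ u < v := h.not_gt
        tauto
  · have hWpos : 0 < W.card := by omega
    unfold tournChromOn
    apply le_antisymm
    · apply Nat.sInf_le
      obtain ⟨c, h1, h2⟩ := hWc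
      refine ⟨fun i => ⟨c (e i), h1 _ (heW i)⟩, ?_⟩
      intro i x hx y hy z hz
      simp only [Set.mem_univ, true_and, Set.mem_ofPred_eq, Fin.ext_iff] at hx hy hz
      exact h2 i.1 _ ⟨heW x, hx⟩ _ ⟨heW y, hy⟩ _ ⟨heW z, hz⟩
    · apply le_csInf
      · obtain ⟨c, h1, h2⟩ := hWc
        refine ⟨χ, fun i => ⟨c (e i), h1 _ (heW i)⟩, ?_⟩
        intro i x hx y hy z hz
        simp only [Set.mem_univ, true_and, Set.mem_ofPred_eq, Fin.ext_iff] at hx hy hz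
        exact h2 i.1 _ ⟨heW x, hx⟩ _ ⟨heW y, hy⟩ _ ⟨heW z, hz⟩
      · rintro n ⟨c, hc⟩
        apply hWnc
        refine ⟨fun w => if hw : w ∈ W then (c (W.equivFin ⟨w, hw⟩) : ℕ) else 0, ?_, ?_⟩
        · intro v hv
          have hv : v ∈ W := hv
          simp only [hv, dif_pos]
          exact (c _).2
        · rintro i x ⟨hx, hx'⟩ y ⟨hy, hy'⟩ z ⟨hz, hz'⟩ hxy hyz
          obtain ⟨x, rfl⟩ := hesurj x hx
          obtain ⟨y, rfl⟩ := hesurj y hy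
          obtain ⟨z, rfl⟩ := hesurj z hz
          simp only [heW, dif_pos, e, Subtype.coe_eta, Equiv.apply_symm_apply] at hx' hy' hz'
          refine hc (c x) x ⟨trivial, rfl⟩ y ⟨trivial, ?_⟩ z ⟨trivial, ?_⟩ hxy hyz
          · exact Fin.ext (hy'.trans hx'.symm)
          · exact Fin.ext (hz'.trans hx'.symm)
  · intro U hU
    have hk := final_arith χ s R W.card hχ hR (by omega) (by omega) hWcard U.card hU
    obtain ⟨a, ha⟩ := hdom (U.biUnion (fun v => zeros (e v).1)) (by
      refine (Finset.card_biUnion_le_card_mul _ _ χ ?_).trans hk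
      intro v _
      have := hWV (heW v)
      simp only [VV, Finset.mem_product] at this
      exact QS_zeros this.1)
    have hna : ∀ u, (∃ v ∈ U, dm v u ∨ (¬ dm u v ∧ v < u)) → (e u).1 a ≠ 0 := by
      rintro u ⟨v, hv, h⟩ h0
      have hdu : dm u v := ⟨a, (mem_zeros _ _).2 h0, fun b hb => ha b (Finset.mem_biUnion.2 ⟨v, hv, hb⟩)⟩
      rcases h with h | h
      · exact hdm2 _ _ h hdu
      · exact h.1 hdu
    unfold tournChromOn
    apply Nat.sInf_le
    refine ⟨fun u => if (e u).1 a = 1 then 0 else 1, ?_⟩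
    intro i
    have key : TransOn r {w | w ∈ W ∧ w.1 a ≠ 0 ∧ (if w.1 a = 1 then (0 : Fin 2) else 1) = i} := by
      apply R1_trans
      rintro u ⟨_, hu, hu'⟩ v ⟨_, hv, hv'⟩ hO
      refine hu (hO a ?_)
      rw [← hv'] at hu'
      revert hu hv hu'
      cases u.1 a <;> cases v.1 a <;> decide
    rintro x ⟨hx, hx'⟩ y ⟨hy, hy'⟩ z ⟨hz, hz'⟩
    exact key _ ⟨heW x, hna x hx, hx'⟩ _ ⟨heW y, hna y hy, hy'⟩ _ ⟨heW z, hna z hz, hz'⟩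
end
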